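/- Assume α ∈ (0,2], the Hurst functional index H satisfies (H₁) and (H₂), let d ≥ 1 be an integer, let I := [ε,T]^N with 0 < ε < T, and assume d < inf_{v∈I} ∑_{l=1}^N 1/h_l(v). For an even integer n ≥ 2, a cube I_{a,δ} = ∏_{l=1}^N [a_l, a_l + δ] ⊆ I and x, y ∈ ℝ^d, define D_n(x,y) := (2π)^{−nd} ∫_{(I_{a,δ})^n} ∫_{ℝ^{nd}} ∏_{j=1}^n (e^{−i⟨v^j, x⟩} − e^{−i⟨v^j, y⟩}) · exp(−∑_{k=1}^d ∫_{ℝ^N} |∑_{j=1}^n v_k^j · g^{H(u^j)}(u^j, w)|^α dw) dv^1…dv^n du^1…du^n, where v^j = (v_1^j,…,v_d^j) ∈ ℝ^d. Then for every even integer n ≥ 2 and every κ > 0 there exist constants c > 0 and δ₀ ∈ (0,1] such that for every cube I_{a,δ} ⊆ I with δ ∈ (0,δ₀], every u* ∈ I_{a,δ} and every permutation σ of {1,…,N} satisfying n·κ < min(1, α_σ(u*)/(2·γ_σ(u*))), and all x, y ∈ ℝ^d with |x − y| ≤ 1: |D_n(x,y)| ≤ c · |x−y|^{n·κ} · δ^{n·(β_σ(u*)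 − (n−1)·h_{σ(γ_σ(u*))}(u*)·κ)}. -/

import Mathlib

open MeasureTheory Finset
open scoped ENNReal

/-- `(a₊)^c` with the convention `0^c := 0` for every real exponent `c`. -/
noncomputable def ppow (a c : ℝ) : ℝ := if 0 < a then a ^ c else 0

/-- The multifractional kernel `g^{H(u)}(u,w)`. -/
noncomputable def kernelG (N : ℕ) (α : ℝ) (h : Fin N → (Fin N → ℝ) → ℝ)
    (u w : Fin N → ℝ) : ℝ :=
  ∏ l, (ppow (u l - w l) (h l u - 1 / α) - ppow (-w l) (h l u - 1 / α))

/-- The moment of local-time differences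
`D_n(x,y) = (2π)^{-nd} ∫_{C^n} ∫_{ℝ^{nd}} ∏_j (e^{-i⟨v^j,x⟩} - e^{-i⟨v^j,y⟩})
    exp(-∑_k ∫_{ℝ^N} |∑_j v_k^j g^{H(u^j)}(u^j,w)|^α dw) dv du`. -/
noncomputable def Dn (N d : ℕ) (α : ℝ) (h : Fin N → (Fin N → ℝ) → ℝ)
    (n : ℕ) (C : Set (Fin N → ℝ)) (x y : EuclideanSpace ℝ (Fin d)) : ℂ :=
  (((2 * Real.pi) ^ (-((n : ℝ) * d)) : ℝ) : ℂ) *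
    ∫ U : Fin n → Fin N → ℝ in {U | ∀ j, U j ∈ C},
      ∫ V : Fin n → EuclideanSpace ℝ (Fin d),
        (∏ j, (Complex.exp (-((∑ k, V j k * x k : ℝ) : ℂ) * Complex.I) -
               Complex.exp (-((∑ k, V j k * y k : ℝ) : ℂ) * Complex.I))) *
          Complex.exp (-((∑ k : Fin d, ∫ w : Fin N → ℝ,
            |∑ j, V j k * kernelG N α h (U j) w| ^ α : ℝ) : ℂ))

/-- `γ_σ(v) = min{m : d < ∑_{l=1}^m 1/h_{σ(l)}(v)}` (a natural number). -/
noncomputable def gammaIdx (N d : ℕ) (h : Fin N → (Fin N → ℝ) → ℝ)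
    (σ : Equiv.Perm (Fin N)) (v : Fin N → ℝ) : ℕ :=
  sInf {mm : ℕ |
    (d : ℝ) < ∑ l ∈ Finset.univ.filter (fun l : Fin N => (l : ℕ) < mm), 1 / h (σ l) v}

/-- `β_σ(v) = N - γ_σ(v) + h_{σ(γ_σ(v))}(v)(∑_{l=1}^{γ_σ(v)} 1/h_{σ(l)}(v) - d)`. -/
noncomputable def betaFn (N d : ℕ) (h : Fin N → (Fin N → ℝ) → ℝ)
    (σ : Equiv.Perm (Fin N)) (v : Fin N → ℝ) : ℝ :=
  if hγ : gammaIdx N d h σ v - 1 < N then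
    (N : ℝ) - gammaIdx N d h σ v +
      h (σ ⟨gammaIdx N d h σ v - 1, hγ⟩) v *
        ((∑ l ∈ Finset.univ.filter (fun l : Fin N => (l : ℕ) < gammaIdx N d h σ v),
            1 / h (σ l) v) - d)
  else 0

/-- `α_σ(v) = ∑_{l=1}^{γ_σ(v)} 1/h_{σ(l)}(v) - d`. -/
noncomputable def alphaFn (N d : ℕ) (h : Fin N → (Fin N → ℝ) → ℝ)
    (σ : Equiv.Perm (Fin N)) (v : Fin N → ℝ) : ℝ :=
  (∑ l ∈ Finset.univ.filter (fun l : Fin N => (l : ℕ) < gammaIdx N d h σ v),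
    1 / h (σ l) v) - d

/-- `h_{σ(γ_σ(v))}(v)`. -/
noncomputable def hGamma (N d : ℕ) (h : Fin N → (Fin N → ℝ) → ℝ)
    (σ : Equiv.Perm (Fin N)) (v : Fin N → ℝ) : ℝ :=
  if hγ : gammaIdx N d h σ v - 1 < N then h (σ ⟨gammaIdx N d h σ v - 1, hγ⟩) v else 0

lemma abs_sum_rpow_le {ι : Type*} (s : Finset ι) {α : ℝ} (hα0 : 0 < α) (hα2 : α ≤ 2)
    (a : ι → ℝ) : |∑ j ∈ s, a j| ^ α ≤ (#s : ℝ) ^ 2 * ∑ j ∈ s, |a j| ^ α := by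
  rcases s.eq_empty_or_nonempty with rfl | hs
  · simp [Real.zero_rpow hα0.ne']
  obtain ⟨j, hj, hmax⟩ := s.exists_max_image (fun j => |a j|) hs
  have h1 : |∑ j ∈ s, a j| ≤ #s * |a j| := by
    refine (abs_sum_le_sum_abs _ _).trans ?_
    simpa using sum_le_card_nsmul s (fun j => |a j|) _ hmax
  have hc : (1 : ℝ) ≤ #s := by exact_mod_cast hs.card_pos
  calc |∑ j ∈ s, a j| ^ α ≤ (#s * |a j|) ^ α := by gcongr
    _ = (#s : ℝ) ^ α * |a j| ^ α := Real.mul_rpow (by positivity) (abs_nonneg _)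
    _ ≤ (#s : ℝ) ^ 2 * ∑ j ∈ s, |a j| ^ α := by
        gcongr
        · exact (Real.rpow_le_rpow_of_exponent_le hc hα2).trans_eq (by norm_cast)
        · exact single_le_sum (f := fun j => |a j| ^ α) (fun i _ => by positivity) hj

lemma abs_add_rpow_le {α : ℝ} (hα0 : 0 < α) (hα2 : α ≤ 2) (a b : ℝ) :
    |a + b| ^ α ≤ 4 * (|a| ^ α + |b| ^ α) := by
  have := abs_sum_rpow_le (Finset.univ : Finset (Fin 2)) hα0 hα2 ![a, b]
  norm_num at this
  linarith

lemma abs_sub_rpow_le {α : ℝ} (hα0 : 0 < α) (hα2 : α ≤ 2) (a b : ℝ) :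
    |a - b| ^ α ≤ 4 * (|a| ^ α + |b| ^ α) := by
  simpa [sub_eq_add_neg] using abs_add_rpow_le hα0 hα2 a (-b)

lemma lintegral_exp_neg_mul_abs_rpow {α b : ℝ} (hα : 0 < α) (hb : 0 < b) :
    ∫⁻ v : ℝ, ENNReal.ofReal (Real.exp (-b * |v| ^ α)) =
      ENNReal.ofReal (2 * (b ^ (-1 / α) * Real.Gamma (1 / α + 1))) := by
  have h1 := integral_exp_neg_mul_rpow hα hb
  have hpos : 0 < b ^ (-1 / α) * Real.Gamma (1 / α + 1) :=
    mul_pos (by positivity) (Real.Gamma_pos_of_pos (by positivity))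
  have h2 := integral_comp_abs (f := fun x : ℝ => Real.exp (-b * x ^ α))
  have hint' : Integrable (fun x : ℝ => Real.exp (-b * |x| ^ α)) := by
    by_contra hcon
    rw [integral_undef hcon, h1] at h2
    linarith
  rw [← ofReal_integral_eq_lintegral_ofReal hint' (.of_forall fun _ => by positivity),
    h2, h1]

lemma exists_lintegral_exp_neg_le_of_separated {α : ℝ} (hα : 0 < α) :
    ∃ C > (0 : ℝ), ∀ (b : ℝ) (ψ : ℝ → ℝ), 0 < b → (∀ v, 0 ≤ ψ v) →
      (∀ v v', b * |v - v'| ^ α ≤ 4 * (ψ v + ψ v')) →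
      ∫⁻ v, ENNReal.ofReal (Real.exp (-(1 / 2) * ψ v)) ≤
        ENNReal.ofReal (C * b ^ (-1 / α)) := by
  have hG : 0 < Real.Gamma (1 / α + 1) := Real.Gamma_pos_of_pos (by positivity)
  refine ⟨Real.exp (1 / 4) * (2 * ((1 / 16) ^ (-1 / α) * Real.Gamma (1 / α + 1))),
    by positivity, fun b ψ hb hψ hsep => ?_⟩
  obtain ⟨v₀, hv₀⟩ : ∃ v₀, ∀ v, ψ v₀ ≤ ψ v + 1 := by
    have hbdd : BddBelow (Set.range ψ) := ⟨0, by rintro _ ⟨v, rfl⟩; exact hψ v⟩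
    obtain ⟨v₀, hv₀⟩ := exists_lt_of_ciInf_lt (lt_add_one (⨅ v, ψ v))
    exact ⟨v₀, fun v => hv₀.le.trans (by linarith [ciInf_le hbdd v])⟩
  have hpt : ∀ v, Real.exp (-(1 / 2) * ψ v) ≤
      Real.exp (1 / 4) * Real.exp (-(b / 16) * |v - v₀| ^ α) := fun v => by
    rw [← Real.exp_add]
    apply Real.exp_le_exp.2
    linarith [hsep v v₀, hv₀ v]
  calc ∫⁻ v, ENNReal.ofReal (Real.exp (-(1 / 2) * ψ v))
      ≤ ∫⁻ v, ENNReal.ofReal (Real.exp (1 / 4)) *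
          ENNReal.ofReal (Real.exp (-(b / 16) * |v - v₀| ^ α)) := by
        refine lintegral_mono fun v => ?_
        rw [← ENNReal.ofReal_mul (Real.exp_pos _).le]
        exact ENNReal.ofReal_le_ofReal (hpt v)
    _ = ENNReal.ofReal (Real.exp (1 / 4)) *
          ENNReal.ofReal (2 * ((b / 16) ^ (-1 / α) * Real.Gamma (1 / α + 1))) := by
        rw [lintegral_const_mul' _ _ ENNReal.ofReal_ne_top,
          lintegral_sub_right_eq_self
            (fun v : ℝ => ENNReal.ofReal (Real.exp (-(b / 16) * |v| ^ α))) v₀,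
          lintegral_exp_neg_mul_abs_rpow hα (by positivity)]
    _ ≤ _ := by
        rw [← ENNReal.ofReal_mul (Real.exp_pos _).le, div_eq_mul_one_div b,
          Real.mul_rpow hb.le (by norm_num)]
        exact ENNReal.ofReal_le_ofReal (le_of_eq (by ring))

section Strips

variable {Ω : Type*} [MeasurableSpace Ω] {μ : Measure Ω}

lemma integrable_abs_sum_rpow {n : ℕ} {α : ℝ} (hα0 : 0 < α) (hα2 : α ≤ 2) {g : Fin n → Ω → ℝ}
    (hgm : ∀ j, Measurable (g j)) (hgi : ∀ j, Integrable (fun w => |g j w| ^ α) μ)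
    (v : Fin n → ℝ) : Integrable (fun w => |∑ j, v j * g j w| ^ α) μ := by
  have hdom : Integrable (fun w => (n : ℝ) ^ 2 * ∑ j, |v j| ^ α * |g j w| ^ α) μ :=
    (integrable_finsetSum _ fun j _ => (hgi j).const_mul _).const_mul _
  refine hdom.mono' (Measurable.aestronglyMeasurable (by fun_prop)) (.of_forall fun w => ?_)
  rw [Real.norm_of_nonneg (by positivity)]
  have := abs_sum_rpow_le Finset.univ hα0 hα2 (fun j => v j * g j w)
  simpa [abs_mul, Real.mul_rpow] using this

lemma measurable_integral_abs_sum_rpow [SFinite μ] {n : ℕ} {α : ℝ} {g : Fin n → Ω → ℝ}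
    (hgm : ∀ j, Measurable (g j)) :
    Measurable (fun v : Fin n → ℝ => ∫ w, |∑ j, v j * g j w| ^ α ∂μ) := by
  refine (StronglyMeasurable.integral_prod_right' (f := fun p : (Fin n → ℝ) × Ω =>
    |∑ j, p.1 j * g j p.2| ^ α) ?_).measurable
  refine Measurable.stronglyMeasurable ?_
  have : Measurable fun p : (Fin n → ℝ) × Ω => ∑ j, p.1 j * g j p.2 :=
    Finset.measurable_fun_sum _ fun j _ =>
      ((measurable_pi_apply j).comp measurable_fst).mul ((hgm j).comp measurable_snd)
  fun_prop

/-- Triangular systems: if `g j` vanishes on the `i`-th strip for `j < i`, the Laplace-type integral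
over the coefficients is controlled by the norms of `g i` on the `i`-th strip. -/
lemma exists_lintegral_exp_neg_strips_le [SFinite μ] {α : ℝ} (hα0 : 0 < α) (hα2 : α ≤ 2) :
    ∃ C > (0 : ℝ), ∀ (n : ℕ) (g : Fin n → Ω → ℝ) (S : Fin n → Set Ω) (b : Fin n → ℝ),
      (∀ j, Measurable (g j)) → (∀ j, Integrable (fun w => |g j w| ^ α) μ) →
      (∀ i, MeasurableSet (S i)) → (∀ i j, j < i → ∀ w ∈ S i, g j w = 0) →
      (∀ i, 0 < b i) → (∀ i, b i ≤ ∫ w in S i, |g i w| ^ α ∂μ) →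
      ∫⁻ v : Fin n → ℝ, ENNReal.ofReal
          (Real.exp (-(1 / 2) * ∑ i, ∫ w in S i, |∑ j, v j * g j w| ^ α ∂μ)) ≤
        ENNReal.ofReal (∏ i, (C * b i ^ (-1 / α))) := by
  obtain ⟨C, hC, hsep⟩ := exists_lintegral_exp_neg_le_of_separated hα0
  refine ⟨C, hC, fun n => ?_⟩
  induction n with
  | zero => intro g S b _ _ _ _ _ _; simp [volume_pi]
  | succ n ih =>
    intro g S b hgm hgi hS hzero hb hbS
    have hmp := (volume_preserving_piFinSuccAbove (fun _ : Fin (n + 1) => ℝ) 0).symm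
    rw [← hmp.lintegral_comp_emb (MeasurableEquiv.measurableEmbedding _), Measure.volume_eq_prod]
    have hsymm : ∀ p : ℝ × (Fin n → ℝ),
        (MeasurableEquiv.piFinSuccAbove (fun _ : Fin (n + 1) => ℝ) 0).symm p =
          (Fin.cons p.1 p.2 : Fin (n + 1) → ℝ) := fun p => by
      simp [MeasurableEquiv.piFinSuccAbove, Fin.insertNthEquiv]
    simp only [hsymm]
    have htail : ∀ (v₀ : ℝ) (v : Fin n → ℝ) (i : Fin n),
        ∫ w in S i.succ, |∑ j, (Fin.cons v₀ v : Fin (n + 1) → ℝ) j * g j w| ^ α ∂μ =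
          ∫ w in S i.succ, |∑ j : Fin n, v j * g j.succ w| ^ α ∂μ := fun v₀ v i =>
      setIntegral_congr_fun (hS _) fun w hw => by
        simp [Fin.sum_univ_succ, hzero i.succ 0 (Fin.succ_pos i) w hw]
    have hmeas : Measurable fun p : ℝ × (Fin n → ℝ) => ENNReal.ofReal (Real.exp (-(1 / 2) *
        ∑ i, ∫ w in S i, |∑ j, (Fin.cons p.1 p.2 : Fin (n + 1) → ℝ) j * g j w| ^ α ∂μ)) := by
      refine ENNReal.measurable_ofReal.comp (Real.measurable_exp.comp
        (Measurable.const_mul (Finset.measurable_fun_sum _ fun i _ => ?_) _))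
      have h1 := measurable_integral_abs_sum_rpow (μ := μ.restrict (S i)) (α := α) hgm
      exact h1.comp (measurable_pi_iff.2 fun j => by
        refine Fin.cases ?_ (fun j => ?_) j
        · simpa using measurable_fst
        · simpa [Function.comp_def] using (measurable_pi_apply j).comp measurable_snd)
    rw [lintegral_prod_symm _ hmeas.aemeasurable]
    have hstep : ∀ v : Fin n → ℝ, ∫⁻ v₀ : ℝ, ENNReal.ofReal (Real.exp (-(1 / 2) *
        ∑ i, ∫ w in S i, |∑ j, (Fin.cons v₀ v : Fin (n + 1) → ℝ) j * g j w| ^ α ∂μ)) ≤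
        ENNReal.ofReal (C * b 0 ^ (-1 / α)) * ENNReal.ofReal (Real.exp (-(1 / 2) *
          ∑ i : Fin n, ∫ w in S i.succ, |∑ j : Fin n, v j * g j.succ w| ^ α ∂μ)) := by
      intro v
      simp only [Fin.sum_univ_succ (n := n) (f := fun i => ∫ w in S i, _ ∂μ), htail, mul_add,
        Real.exp_add, ENNReal.ofReal_mul (Real.exp_pos _).le]
      rw [lintegral_mul_const' _ _ ENNReal.ofReal_ne_top]
      gcongr
      refine hsep (b 0) (fun v₀ => ∫ w in S 0,
        |∑ j, (Fin.cons v₀ v : Fin (n + 1) → ℝ) j * g j w| ^ α ∂μ) (hb 0)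
        (fun v₀ => integral_nonneg fun w => by positivity) fun x x' => ?_
      have hi : ∀ v : Fin (n + 1) → ℝ, IntegrableOn (fun w => |∑ j, v j * g j w| ^ α) (S 0) μ :=
        fun v => (integrable_abs_sum_rpow hα0 hα2 hgm hgi v).integrableOn
      calc b 0 * |x - x'| ^ α ≤ (∫ w in S 0, |g 0 w| ^ α ∂μ) * |x - x'| ^ α := by
            gcongr; exact hbS 0
        _ = ∫ w in S 0, |g 0 w| ^ α * |x - x'| ^ α ∂μ := (integral_mul_const _ _).symm
        _ ≤ ∫ w in S 0, 4 * (|∑ j, (Fin.cons x v : Fin (n + 1) → ℝ) j * g j w| ^ α +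
              |∑ j, (Fin.cons x' v : Fin (n + 1) → ℝ) j * g j w| ^ α) ∂μ := by
            refine setIntegral_mono ((hgi 0).integrableOn.mul_const _)
              (((hi _).add (hi _)).const_mul _) fun w => ?_
            have h2 := abs_sub_rpow_le hα0 hα2
              (∑ j, (Fin.cons x v : Fin (n + 1) → ℝ) j * g j w)
              (∑ j, (Fin.cons x' v : Fin (n + 1) → ℝ) j * g j w)
            have h3 : (∑ j, (Fin.cons x v : Fin (n + 1) → ℝ) j * g j w) -
              (∑ j, (Fin.cons x' v : Fin (n + 1) → ℝ) j * g j w) = g 0 w * (x - x') := by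
              simp [Fin.sum_univ_succ]; ring
            rwa [h3, abs_mul, Real.mul_rpow (abs_nonneg _) (abs_nonneg _)] at h2
        _ = _ := by
            rw [integral_const_mul, integral_add (hi _) (hi _)]
    calc _ ≤ ∫⁻ v : Fin n → ℝ, ENNReal.ofReal (C * b 0 ^ (-1 / α)) *
          ENNReal.ofReal (Real.exp (-(1 / 2) *
          ∑ i : Fin n, ∫ w in S i.succ, |∑ j : Fin n, v j * g j.succ w| ^ α ∂μ)) :=
          lintegral_mono hstep
      _ ≤ ENNReal.ofReal (C * b 0 ^ (-1 / α)) *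
          ENNReal.ofReal (∏ i : Fin n, (C * b i.succ ^ (-1 / α))) := by
          rw [lintegral_const_mul' _ _ ENNReal.ofReal_ne_top]
          gcongr
          exact ih (fun j => g j.succ) (fun i => S i.succ) (fun i => b i.succ) (fun j => hgm _)
            (fun j => hgi _) (fun i => hS _)
            (fun i j hij => hzero i.succ j.succ (Fin.succ_lt_succ_iff.2 hij))
            (fun i => hb _) (fun i => hbS _)
      _ = _ := by
          have := hb 0
          rw [← ENNReal.ofReal_mul (by positivity), Fin.prod_univ_succ]

/-- Back substitution in a triangular system bounds each coefficient by the total energy. -/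
lemma exists_abs_coeff_rpow_le {α K : ℝ} (hα0 : 0 < α) (hα2 : α ≤ 2) (hK : 0 ≤ K) (n : ℕ) :
    ∃ C > (0 : ℝ), ∀ (g : Fin n → Ω → ℝ) (S : Fin n → Set Ω) (B : Fin n → ℝ),
      (∀ j, Measurable (g j)) → (∀ j, Integrable (fun w => |g j w| ^ α) μ) →
      (∀ i, MeasurableSet (S i)) → (∀ i j, j < i → ∀ w ∈ S i, g j w = 0) →
      (∀ i, 1 ≤ B i) → (∀ i, 1 ≤ B i * ∫ w in S i, |g i w| ^ α ∂μ) →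
      (∀ i j, i < j → ∫ w in S i, |g j w| ^ α ∂μ ≤ K) →
      ∀ (v : Fin n → ℝ) (W : ℝ), (∀ i, ∫ w in S i, |∑ j, v j * g j w| ^ α ∂μ ≤ W) →
        ∀ j, |v j| ^ α ≤ C * (∏ i, B i) * W := by
  induction n with
  | zero => exact ⟨1, one_pos, fun _ _ _ _ _ _ _ _ _ _ _ _ _ j => j.elim0⟩
  | succ n ih =>
    obtain ⟨C, hC, ih⟩ := ih
    refine ⟨max C (4 * (1 + (n : ℝ) ^ 2 * n * K * C)), by positivity,
      fun g S B hgm hgi hS hzero hB hBS hKS v W hW => ?_⟩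
    have hW0 : 0 ≤ W := le_trans (integral_nonneg fun w => by positivity) (hW 0)
    have hP1 : ∀ s : Finset (Fin n), 1 ≤ ∏ i ∈ s, B i.succ := fun s =>
      Finset.one_le_prod fun i _ => hB _
    have hprod : ∏ i, B i = B 0 * ∏ i : Fin n, B i.succ := Fin.prod_univ_succ _
    have hP := hP1 univ
    set P := ∏ i : Fin n, B i.succ with hPdef
    have hB0 := hB 0
    have htail : ∀ j : Fin n, |v j.succ| ^ α ≤ C * P * W := by
      refine ih (fun j => g j.succ) (fun i => S i.succ) (fun i => B i.succ) (fun j => hgm _)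
        (fun j => hgi _) (fun i => hS _)
        (fun i j hij => hzero i.succ j.succ (Fin.succ_lt_succ_iff.2 hij))
        (fun i => hB _) (fun i => hBS _)
        (fun i j hij => hKS _ _ (Fin.succ_lt_succ_iff.2 hij)) (fun j => v j.succ) W fun i => ?_
      refine le_trans (le_of_eq ?_) (hW i.succ)
      exact setIntegral_congr_fun (hS _) fun w hw => by
        simp [Fin.sum_univ_succ, hzero i.succ 0 (Fin.succ_pos i) w hw]
    intro j
    rw [hprod]
    refine Fin.cases ?_ (fun j => ?_) j
    · have hi : IntegrableOn (fun w => |∑ j, v j * g j w| ^ α) (S 0) μ :=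
        (integrable_abs_sum_rpow hα0 hα2 hgm hgi v).integrableOn
      have hi' : IntegrableOn (fun w => (n : ℝ) ^ 2 * ∑ j : Fin n, C * P * W * |g j.succ w| ^ α)
          (S 0) μ := ((integrable_finsetSum _ fun j _ => (hgi _).const_mul _).const_mul _).integrableOn
      have h1 : |v 0| ^ α * ∫ w in S 0, |g 0 w| ^ α ∂μ ≤
          4 * (W + (n : ℝ) ^ 2 * ∑ j : Fin n, C * P * W * K) := by
        rw [← integral_const_mul]
        calc ∫ w in S 0, |v 0| ^ α * |g 0 w| ^ α ∂μ
            ≤ ∫ w in S 0, 4 * (|∑ j, v j * g j w| ^ α +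
                (n : ℝ) ^ 2 * ∑ j : Fin n, C * P * W * |g j.succ w| ^ α) ∂μ := by
              refine setIntegral_mono ((hgi 0).integrableOn.const_mul _)
                ((hi.add hi').const_mul _) fun w => ?_
              have h2 := abs_sub_rpow_le hα0 hα2 (∑ j, v j * g j w)
                (∑ j : Fin n, v j.succ * g j.succ w)
              have h3 := abs_sum_rpow_le univ hα0 hα2 (fun j : Fin n => v j.succ * g j.succ w)
              rw [Fin.sum_univ_succ, add_sub_cancel_right, ← Fin.sum_univ_succ (fun j => v j * g j w), abs_mul,
                Real.mul_rpow (abs_nonneg _) (abs_nonneg _)] at h2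
              refine h2.trans ?_
              gcongr
              refine h3.trans ?_
              simp only [card_univ, Fintype.card_fin]
              gcongr with j
              rw [abs_mul, Real.mul_rpow (abs_nonneg _) (abs_nonneg _)]
              gcongr
              exact htail j
          _ = 4 * ((∫ w in S 0, |∑ j, v j * g j w| ^ α ∂μ) +
                (n : ℝ) ^ 2 * ∑ j : Fin n, C * P * W * ∫ w in S 0, |g j.succ w| ^ α ∂μ) := by
              rw [integral_const_mul, integral_add hi hi', integral_const_mul,
                integral_finsetSum _ fun j _ => ((hgi _).const_mul _).integrableOn]
              simp only [integral_const_mul]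
          _ ≤ _ := by
              gcongr with j
              · exact hW 0
              · exact hKS 0 j.succ (Fin.succ_pos j)
      have hv : (0 : ℝ) ≤ |v 0| ^ α := by positivity
      calc |v 0| ^ α ≤ |v 0| ^ α * (B 0 * ∫ w in S 0, |g 0 w| ^ α ∂μ) :=
            le_mul_of_one_le_right hv (hBS 0)
        _ = B 0 * (|v 0| ^ α * ∫ w in S 0, |g 0 w| ^ α ∂μ) := by ring
        _ ≤ B 0 * (4 * (W + (n : ℝ) ^ 2 * ∑ j : Fin n, C * P * W * K)) := by gcongr
        _ = B 0 * (4 * (1 * W + (n : ℝ) ^ 2 * n * K * C * (P * W))) := by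
            simp only [sum_const, card_univ, Fintype.card_fin, nsmul_eq_mul]; ring
        _ ≤ B 0 * (4 * (P * W + (n : ℝ) ^ 2 * n * K * C * (P * W))) := by gcongr
        _ = 4 * (1 + (n : ℝ) ^ 2 * n * K * C) * (B 0 * P) * W := by ring
        _ ≤ _ := by gcongr; exact le_max_right _ _
    · refine (htail j).trans ?_
      gcongr
      · exact le_max_left _ _
      · exact le_mul_of_one_le_left (by positivity) hB0

end Strips

lemma measurable_ppow (c : ℝ) : Measurable fun a : ℝ => ppow a c :=
  Measurable.ite measurableSet_Ioi (by fun_prop) measurable_const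

lemma measurable_kernelG (N : ℕ) (α : ℝ) (h : Fin N → (Fin N → ℝ) → ℝ) (u : Fin N → ℝ) :
    Measurable (kernelG N α h u) := by
  refine Finset.measurable_fun_prod _ fun l _ => Measurable.sub ?_ ?_
  · exact (measurable_ppow _).comp (measurable_const.sub (measurable_pi_apply l))
  · exact (measurable_ppow _).comp (measurable_pi_apply l).neg

lemma abs_ppow_rpow_le {α : ℝ} (hα : 0 < α) (a c : ℝ) : |ppow a c| ^ α ≤ |a ^ (c * α)| := by
  unfold ppow
  split_ifs with ha
  · rw [abs_of_pos (by positivity), ← Real.rpow_mul ha.le]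
    exact le_abs_self _
  · simp [Real.zero_rpow hα.ne']

lemma abs_add_rpow_sub_rpow_le {x u c : ℝ} (hx : 0 < x) (hu : 0 ≤ u) (hc : c ≤ 1) :
    |(u + x) ^ c - x ^ c| ≤ |c| * x ^ (c - 1) * u := by
  have := Convex.norm_image_sub_le_of_norm_hasDerivWithin_le (f := fun y : ℝ => y ^ c)
    (f' := fun y => c * y ^ (c - 1)) (C := |c| * x ^ (c - 1)) (s := Set.Ici x) (x := x) (y := u + x)
    (fun y hy => (Real.hasDerivAt_rpow_const
      (Or.inl (hx.trans_le hy).ne')).hasDerivWithinAt)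
    (fun y hy => by
      have hy0 : 0 < y := hx.trans_le hy
      rw [norm_mul, Real.norm_eq_abs, Real.norm_of_nonneg (by positivity)]
      gcongr ?_ * ?_
      exact Real.rpow_le_rpow_of_nonpos hx hy (by linarith))
    (convex_Ici x) Set.self_mem_Ici (by simpa using hu)
  simpa [abs_of_nonneg hu] using this

lemma integrable_abs_ppow_sub_ppow_rpow {α η u : ℝ} (hα0 : 0 < α) (hα2 : α ≤ 2) (hη0 : 0 < η)
    (hη1 : η < 1) (hu : 0 < u) :
    Integrable fun w : ℝ => |ppow (u - w) (η - 1 / α) - ppow (-w) (η - 1 / α)| ^ α := by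
  have he : (η - 1 / α) * α = α * η - 1 := by field_simp
  have hmeas : Measurable fun w : ℝ =>
      |ppow (u - w) (η - 1 / α) - ppow (-w) (η - 1 / α)| ^ α := by
    have h1 := (measurable_ppow (η - 1 / α)).comp (measurable_const (a := u) |>.sub measurable_id)
    have h2 := (measurable_ppow (η - 1 / α)).comp (measurable_neg (G := ℝ))
    exact ((h1.sub h2).abs).pow_const α
  have hleft : IntegrableOn (fun w : ℝ =>
      |ppow (u - w) (η - 1 / α) - ppow (-w) (η - 1 / α)| ^ α) (Set.Iio (-1)) := by
    have hexp : (η - 1 / α - 1) * α < -1 := by nlinarith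
    have hneg : IntegrableOn (fun w : ℝ => (-w) ^ ((η - 1 / α - 1) * α)) (Set.Iio (-1)) :=
      IntegrableOn.comp_neg_Iio (f := fun t : ℝ => t ^ ((η - 1 / α - 1) * α))
        (integrableOn_Ioi_rpow_of_lt hexp (by norm_num))
    have hdom : IntegrableOn (fun w : ℝ => (|η - 1 / α| * u) ^ α * (-w) ^ ((η - 1 / α - 1) * α))
        (Set.Iio (-1)) :=
      Integrable.const_mul hneg _
    refine Integrable.mono' hdom hmeas.aestronglyMeasurable
      (ae_restrict_of_forall_mem measurableSet_Iio fun w hw => ?_)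
    have hw' : 0 < -w := by have : w < -1 := hw; linarith
    rw [Real.norm_of_nonneg (by positivity), Real.rpow_mul hw'.le,
      ← Real.mul_rpow (by positivity) (by positivity)]
    have hc : η - 1 / α ≤ 1 := by have : 0 < 1 / α := by positivity
                                  linarith
    have := abs_add_rpow_sub_rpow_le hw' hu.le hc
    rw [ppow, ppow, if_pos (by linarith), if_pos hw', sub_eq_add_neg u w]
    gcongr
    linarith
  have hmid : IntegrableOn (fun w : ℝ =>
      |ppow (u - w) (η - 1 / α) - ppow (-w) (η - 1 / α)| ^ α) (Set.Ioc (-1) u) := by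
    have hexp : -1 < α * η - 1 := by nlinarith
    have i1 : IntervalIntegrable (fun w : ℝ => (u - w) ^ (α * η - 1)) volume (-1) u := by
      have := (intervalIntegral.intervalIntegrable_rpow' (a := u + 1) (b := 0) hexp).comp_sub_left u
      simpa using this
    have i2 : IntervalIntegrable (fun w : ℝ => (-w) ^ (α * η - 1)) volume (-1) u := by
      have := (intervalIntegral.intervalIntegrable_rpow' (a := 1) (b := -u) hexp).comp_sub_left 0
      simpa using this
    have hlt : (-1 : ℝ) ≤ u := by linarith
    rw [intervalIntegrable_iff_integrableOn_Ioc_of_le hlt] at i1 i2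
    refine Integrable.mono' ((i1.abs.add i2.abs).const_mul 4) hmeas.aestronglyMeasurable
      (.of_forall fun w => ?_)
    rw [Real.norm_of_nonneg (by positivity)]
    refine (abs_sub_rpow_le hα0 hα2 _ _).trans ?_
    have h1 := abs_ppow_rpow_le hα0 (u - w) (η - 1 / α)
    have h2 := abs_ppow_rpow_le hα0 (-w) (η - 1 / α)
    rw [he] at h1 h2
    simp only [Pi.add_apply]
    gcongr
  have hright : IntegrableOn (fun w : ℝ =>
      |ppow (u - w) (η - 1 / α) - ppow (-w) (η - 1 / α)| ^ α) (Set.Ioi u) := by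
    refine integrableOn_zero.congr_fun (fun w hw => ?_) measurableSet_Ioi
    have hw' : u < w := hw
    rw [ppow, ppow, if_neg (by linarith), if_neg (by linarith), sub_zero, abs_zero,
      Real.zero_rpow hα0.ne']
  rw [← integrableOn_Icc_iff_integrableOn_Ioc] at hmid
  rw [← integrableOn_univ]
  refine ((hleft.union hmid).union hright).mono_set fun w _ => ?_
  simp only [Set.mem_union, Set.mem_Iio, Set.mem_Icc, Set.mem_Ioi]
  rcases lt_or_ge w (-1) with h | h
  · simp [h]
  · rcases le_or_gt w u with h' | h' <;> simp [h, h']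

lemma integrable_abs_kernelG_rpow {N : ℕ} {α : ℝ} (hα0 : 0 < α) (hα2 : α ≤ 2)
    {h : Fin N → (Fin N → ℝ) → ℝ} {u : Fin N → ℝ} (h0 : ∀ l, 0 < h l u) (h1 : ∀ l, h l u < 1)
    (hu : ∀ l, 0 < u l) : Integrable fun w => |kernelG N α h u w| ^ α := by
  have := Integrable.fintype_prod (μ := fun _ : Fin N => (volume : Measure ℝ))
    (f := fun l w => |ppow (u l - w) (h l u - 1 / α) - ppow (-w) (h l u - 1 / α)| ^ α)
    fun l => integrable_abs_ppow_sub_ppow_rpow hα0 hα2 (h0 l) (h1 l) (hu l)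
  refine this.congr (.of_forall fun w => ?_)
  simp only [kernelG, Finset.abs_prod]
  exact Real.finsetProd_rpow _ _ (fun i _ => abs_nonneg _) _

lemma abs_kernelG_rpow_eq {N : ℕ} {α : ℝ} (hα0 : 0 < α) {h : Fin N → (Fin N → ℝ) → ℝ}
    {u w : Fin N → ℝ} (hw : ∀ l, 0 < w l) (hwu : ∀ l, w l < u l) :
    |kernelG N α h u w| ^ α = ∏ l, (u l - w l) ^ (α * h l u - 1) := by
  simp only [kernelG, Finset.abs_prod]
  rw [← Real.finsetProd_rpow _ _ (fun i _ => abs_nonneg _)]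
  refine Finset.prod_congr rfl fun l _ => ?_
  have h1 : 0 < u l - w l := sub_pos.2 (hwu l)
  have h2 : ¬ 0 < -w l := by linarith [hw l]
  rw [ppow, ppow, if_pos h1, if_neg h2, sub_zero, abs_of_pos (by positivity),
    ← Real.rpow_mul h1.le]
  congr 1
  field_simp

lemma kernelG_eq_zero {N : ℕ} {α : ℝ} {h : Fin N → (Fin N → ℝ) → ℝ}
    {u w : Fin N → ℝ} {l : Fin N} (hw : 0 ≤ w l) (hwu : u l ≤ w l) :
    kernelG N α h u w = 0 := by
  refine Finset.prod_eq_zero (mem_univ l) ?_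
  rw [ppow, ppow, if_neg (by linarith), if_neg (by linarith), sub_zero]

lemma volume_real_pi_Ioo {N : ℕ} (lo len : Fin N → ℝ) (hlen : ∀ l, 0 < len l) :
    (volume : Measure (Fin N → ℝ)).real
      (Set.univ.pi fun l => Set.Ioo (lo l) (lo l + len l)) = ∏ l, len l := by
  rw [Measure.real, Real.volume_pi_Ioo]
  simp only [add_sub_cancel_left, ENNReal.toReal_prod]
  exact Finset.prod_congr rfl fun l _ => ENNReal.toReal_ofReal (hlen l).le

section Box

variable {N : ℕ} {α R : ℝ} {h : Fin N → (Fin N → ℝ) → ℝ} {u lo len : Fin N → ℝ}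

lemma setIntegral_box_abs_kernelG_rpow_le (hα0 : 0 < α) (hα2 : α ≤ 2) (h0 : ∀ l, 0 < h l u)
    (h1 : ∀ l, h l u < 1) (hR : 1 ≤ R) (hlo : ∀ l, 0 ≤ lo l) (hlen : ∀ l, 0 < len l)
    (hu : ∀ l, lo l + 2 * len l ≤ u l) (huR : ∀ l, u l ≤ R) :
    ∫ w in Set.univ.pi fun l => Set.Ioo (lo l) (lo l + len l), |kernelG N α h u w| ^ α ≤
      (R ^ 2) ^ N := by
  have hpt : ∀ w ∈ Set.univ.pi fun l => Set.Ioo (lo l) (lo l + len l),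
      ‖|kernelG N α h u w| ^ α‖ ≤ ∏ l, (R ^ 2 / len l) := by
    intro w hw
    simp only [Set.mem_univ_pi, Set.mem_Ioo] at hw
    rw [Real.norm_of_nonneg (by positivity), abs_kernelG_rpow_eq hα0
      (fun l => (hlo l).trans_lt (hw l).1)
      (fun l => by linarith [(hw l).2, hu l, hlen l])]
    refine Finset.prod_le_prod (fun l _ => ?_) fun l _ => ?_
    · have : 0 ≤ u l - w l := by linarith [(hw l).2, hu l, hlen l]
      positivity
    have hx1 : len l ≤ u l - w l := by linarith [(hw l).2, hu l]
    have hx2 : u l - w l ≤ R := by linarith [(hw l).1, hlo l, huR l]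
    have hx0 : 0 < u l - w l := (hlen l).trans_le hx1
    have hle := hlen l
    have hh0 := h0 l
    rw [Real.rpow_sub_one hx0.ne']
    gcongr
    calc (u l - w l) ^ (α * h l u) ≤ R ^ (α * h l u) := by gcongr
      _ ≤ R ^ (2 : ℝ) := Real.rpow_le_rpow_of_exponent_le hR (by nlinarith [h1 l])
      _ = R ^ 2 := by norm_cast
  have hfin : volume (Set.univ.pi fun l => Set.Ioo (lo l) (lo l + len l)) < ⊤ := by
    rw [Real.volume_pi_Ioo]
    exact ENNReal.prod_lt_top fun _ _ => ENNReal.ofReal_lt_top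
  refine (le_abs_self _).trans ((norm_setIntegral_le_of_norm_le_const hfin hpt).trans_eq ?_)
  rw [volume_real_pi_Ioo _ _ hlen, ← Finset.prod_mul_distrib,
    Finset.prod_congr rfl fun l _ => div_mul_cancel₀ _ (hlen l).ne']
  simp

lemma le_setIntegral_box_abs_kernelG_rpow (hα0 : 0 < α) (hα2 : α ≤ 2) (h0 : ∀ l, 0 < h l u)
    (h1 : ∀ l, h l u < 1) (hlo : ∀ l, 0 ≤ lo l) (hlen : ∀ l, 0 < len l)
    (hu : ∀ l, lo l + 2 * len l ≤ u l) (r : Fin N → ℝ) (hr : ∀ l, u l - lo l ≤ r l) :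
    ∏ l, (len l ^ (α * h l u) * (len l / r l)) ≤
      ∫ w in Set.univ.pi fun l => Set.Ioo (lo l) (lo l + len l), |kernelG N α h u w| ^ α := by
  have hupos : ∀ l, 0 < u l := fun l => by linarith [hlo l, hlen l, hu l]
  have hfin : volume (Set.univ.pi fun l => Set.Ioo (lo l) (lo l + len l)) ≠ ⊤ := by
    rw [Real.volume_pi_Ioo]
    exact (ENNReal.prod_lt_top fun _ _ => ENNReal.ofReal_lt_top).ne
  have hpt : ∀ w ∈ Set.univ.pi fun l => Set.Ioo (lo l) (lo l + len l),
      ∏ l, (len l ^ (α * h l u) / r l) ≤ |kernelG N α h u w| ^ α := by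
    intro w hw
    simp only [Set.mem_univ_pi, Set.mem_Ioo] at hw
    rw [abs_kernelG_rpow_eq hα0 (fun l => (hlo l).trans_lt (hw l).1)
      (fun l => by linarith [(hw l).2, hu l, hlen l])]
    have hrpos : ∀ l, 0 < r l := fun l => by linarith [hr l, hu l, hlen l]
    refine Finset.prod_le_prod (fun l _ => ?_) fun l _ => ?_
    · have := hlen l
      have := hrpos l
      positivity
    have hx1 : len l ≤ u l - w l := by linarith [(hw l).2, hu l]
    have hx2 : u l - w l ≤ r l := by linarith [(hw l).1, hr l]
    have hx0 : 0 < u l - w l := (hlen l).trans_le hx1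
    have hle := hlen l
    have hh0 := h0 l
    rw [Real.rpow_sub_one hx0.ne']
    gcongr
  have := setIntegral_ge_of_const_le_real
    (MeasurableSet.univ_pi fun l => measurableSet_Ioo) hfin hpt
    (integrable_abs_kernelG_rpow hα0 hα2 h0 h1 hupos).integrableOn
  rw [volume_real_pi_Ioo _ _ hlen, ← Finset.prod_mul_distrib] at this
  refine le_of_eq_of_le (Finset.prod_congr rfl fun l _ => by ring) this

end Box

/-- Lower corner of the strip on which a kernel is isolated in direction `l`. -/
noncomputable def stripCorner {N : ℕ} (l : Fin N) (a : ℝ) (l' : Fin N) : ℝ :=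
  if l' = l then a else 0

/-- Side lengths of the strip between levels `a` and `t` in direction `l`. -/
noncomputable def stripSide {N : ℕ} (ε : ℝ) (l : Fin N) (a t : ℝ) (l' : Fin N) : ℝ :=
  if l' = l then (t - a) / 2 else ε / 2

/-- The strip: the lower half of `(a, t)` in direction `l`, and `(0, ε / 2)` in the others. -/
def strip {N : ℕ} (ε : ℝ) (l : Fin N) (a t : ℝ) : Set (Fin N → ℝ) :=
  Set.univ.pi fun l' =>
    Set.Ioo (stripCorner l a l') (stripCorner l a l' + stripSide ε l a t l')

lemma measurableSet_strip {N : ℕ} (ε : ℝ) (l : Fin N) (a t : ℝ) :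
    MeasurableSet (strip ε l a t) :=
  MeasurableSet.univ_pi fun _ => measurableSet_Ioo

lemma lt_of_mem_strip {N : ℕ} {ε : ℝ} {l : Fin N} {a t : ℝ} {w : Fin N → ℝ}
    (hw : w ∈ strip ε l a t) : a < w l ∧ w l < (a + t) / 2 := by
  have := hw l (Set.mem_univ l)
  simp only [stripCorner, stripSide, if_true, Set.mem_Ioo] at this
  exact ⟨this.1, by linarith [this.2]⟩

section StripBounds

variable {N : ℕ} {α ε R : ℝ} {h : Fin N → (Fin N → ℝ) → ℝ} {u : Fin N → ℝ} {l : Fin N} {a t : ℝ}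

lemma stripCorner_nonneg (ha : 0 ≤ a) (l' : Fin N) : 0 ≤ stripCorner l a l' := by
  unfold stripCorner; split_ifs <;> simp [ha]

lemma stripSide_pos (hε : 0 < ε) (hat : a < t) (l' : Fin N) : 0 < stripSide ε l a t l' := by
  unfold stripSide; split_ifs <;> linarith

lemma stripCorner_add_le (hu : ∀ l, ε ≤ u l) (htu : t ≤ u l) (l' : Fin N) :
    stripCorner l a l' + 2 * stripSide ε l a t l' ≤ u l' := by
  unfold stripSide stripCorner
  split_ifs with h
  · subst h; linarith
  · linarith [hu l']

lemma setIntegral_strip_le (hα0 : 0 < α) (hα2 : α ≤ 2) (h0 : ∀ l, 0 < h l u)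
    (h1 : ∀ l, h l u < 1) (hε : 0 < ε) (hR : 1 ≤ R) (hu : ∀ l, ε ≤ u l) (huR : ∀ l, u l ≤ R)
    (ha : 0 ≤ a) (hat : a < t) (htu : t ≤ u l) :
    ∫ w in strip ε l a t, |kernelG N α h u w| ^ α ≤ (R ^ 2) ^ N :=
  setIntegral_box_abs_kernelG_rpow_le hα0 hα2 h0 h1 hR (stripCorner_nonneg ha)
    (stripSide_pos hε hat) (stripCorner_add_le hu htu) huR

lemma le_setIntegral_strip (hα0 : 0 < α) (hα2 : α ≤ 2) (h0 : ∀ l, 0 < h l u)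
    (h1 : ∀ l, h l u < 1) (hε : 0 < ε) (hR : 1 ≤ R) (hu : ∀ l, ε ≤ u l) (huR : ∀ l, u l ≤ R)
    (ha : 0 ≤ a) (hat : a < u l) :
    (u l - a) ^ (α * h l u) * (1 / 8 * (min (ε / 2) 1 ^ 3 / R) ^ (N - 1)) ≤
      ∫ w in strip ε l a (u l), |kernelG N α h u w| ^ α := by
  refine le_trans ?_ (le_setIntegral_box_abs_kernelG_rpow hα0 hα2 h0 h1 (stripCorner_nonneg ha)
    (stripSide_pos hε hat) (stripCorner_add_le hu le_rfl)
    (fun l' => if l' = l then u l - a else R) fun l' => ?_)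
  · have hd : 0 < u l - a := sub_pos.2 hat
    have he : 0 < min (ε / 2) 1 := lt_min (by linarith) one_pos
    rw [← Finset.mul_prod_erase univ _ (mem_univ l), ← mul_assoc]
    refine mul_le_mul ?_ ?_ (by positivity) ?_
    · simp only [stripSide, if_true]
      have h4 : (1 / 4 : ℝ) ≤ (1 / 2) ^ (α * h l u) := by
        calc (1 / 4 : ℝ) = (1 / 2) ^ (2 : ℝ) := by norm_num
          _ ≤ _ := Real.rpow_le_rpow_of_exponent_ge (by norm_num) (by norm_num)
            (by nlinarith [h0 l, h1 l])
      have h5 : (u l - a) / 2 / (u l - a) = 1 / 2 := by field_simp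
      rw [h5, div_eq_mul_one_div (u l - a) 2, Real.mul_rpow hd.le (by norm_num)]
      have : 0 < (u l - a) ^ (α * h l u) := by positivity
      nlinarith
    · have hcard : #(univ.erase l) = N - 1 := by simp
      rw [← hcard, ← Finset.prod_const]
      refine Finset.prod_le_prod (fun l' _ => by positivity) fun l' hl' => ?_
      have hne : l' ≠ l := (mem_erase.1 hl').1
      simp only [stripSide, if_neg hne]
      have h6 : min (ε / 2) 1 ^ 2 ≤ (ε / 2) ^ (α * h l' u) := by
        calc min (ε / 2) 1 ^ 2 = min (ε / 2) 1 ^ (2 : ℝ) := by norm_cast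
          _ ≤ min (ε / 2) 1 ^ (α * h l' u) :=
            Real.rpow_le_rpow_of_exponent_ge he (min_le_right _ _) (by nlinarith [h0 l', h1 l'])
          _ ≤ _ := Real.rpow_le_rpow he.le (min_le_left _ _)
              (mul_nonneg hα0.le (h0 l').le)
      calc min (ε / 2) 1 ^ 3 / R = min (ε / 2) 1 ^ 2 * (min (ε / 2) 1 / R) := by ring
        _ ≤ _ := by gcongr; exact min_le_left _ _
    · have := stripSide_pos (l := l) hε hat l
      simp only [if_true]
      positivity
  · unfold stripCorner
    split_ifs with h
    · subst h; rfl
    · linarith [huR l']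

end StripBounds

lemma lintegral_comp_perm {n : ℕ} (π : Equiv.Perm (Fin n)) (f : (Fin n → ℝ) → ℝ≥0∞) :
    ∫⁻ v : Fin n → ℝ, f (fun i => v (π i)) = ∫⁻ v : Fin n → ℝ, f v := by
  have hmp := volume_measurePreserving_piCongrLeft (fun _ : Fin n => ℝ) π
  rw [← hmp.lintegral_comp_emb (MeasurableEquiv.measurableEmbedding _)]
  refine lintegral_congr fun v => congrArg f (funext fun i => ?_)
  exact Equiv.piCongrLeft_apply_apply (fun _ : Fin n => ℝ) π v i

/-- For points ordered in direction `l`, bounds on the Laplace integral and on the coefficients in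
terms of the gaps between consecutive points. -/
lemma exists_ordered_direction_bounds (N : ℕ) {α ε T : ℝ} (hα0 : 0 < α) (hα2 : α ≤ 2)
    (hε : 0 < ε) (k : ℕ) :
    ∃ C ≥ (1 : ℝ), ∀ (h : Fin N → (Fin N → ℝ) → ℝ), (∀ l u, 0 < h l u) → (∀ l u, h l u < 1) →
      ∀ (U : Fin (k + 1) → Fin N → ℝ), (∀ j l, ε ≤ U j l) → (∀ j l, U j l ≤ T) →
      ∀ (l : Fin N) (π : Equiv.Perm (Fin (k + 1))), StrictMono (fun i => U (π i) l) →
      ∀ r : Fin k → ℝ, (∀ i, 1 ≤ r i) →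
        (∀ i, (U (π i.succ) l - U (π i.castSucc) l) ^ (-h l (U (π i.succ))) ≤ r i) →
      (∫⁻ v : Fin (k + 1) → ℝ, ENNReal.ofReal
        (Real.exp (-(1 / 2) * ∫ w, |∑ j, v j * kernelG N α h (U j) w| ^ α)) ≤
          ENNReal.ofReal (C * ∏ i, r i)) ∧
      ∀ (v : Fin (k + 1) → ℝ) j, |v j| ≤ C * (∏ i, r i) * (∫ w, |∑ j, v j * kernelG N α h (U j) w| ^ α) ^ (1 / α) := by
  obtain ⟨C₁, hC₁, hlap⟩ := exists_lintegral_exp_neg_strips_le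
    (Ω := Fin N → ℝ) (μ := volume) hα0 hα2
  set R := max T 1 with hRdef
  have hR : 1 ≤ R := le_max_right _ _
  obtain ⟨C₂, hC₂, hcoef⟩ := exists_abs_coeff_rpow_le
    (Ω := Fin N → ℝ) (μ := volume) (K := (R ^ 2) ^ N) hα0 hα2 (by positivity) (k + 1)
  set e := min (ε / 2) 1 with hedef
  have he : 0 < e := lt_min (by linarith) one_pos
  have he1 : e ≤ 1 := min_le_right _ _
  set c := 1 / 8 * (e ^ 3 / R) ^ (N - 1) with hcdef
  have hc : 0 < c := by positivity
  have hc1 : c ≤ 1 := by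
    have : e ^ 3 / R ≤ 1 := by
      rw [div_le_one (by positivity)]
      exact (pow_le_one₀ he.le he1).trans hR
    have := pow_le_one₀ (n := N - 1) (by positivity) this
    linarith
  set A := (c * e ^ 2)⁻¹ with hAdef
  have hA0 : 0 < A := by positivity
  have hA1 : 1 ≤ A := by
    rw [hAdef, one_le_inv₀ (by positivity)]
    exact mul_le_one₀ hc1 (by positivity) (pow_le_one₀ he.le he1)
  have hα' : 0 < 1 / α := by positivity
  refine ⟨max 1 (max ((C₁ * A ^ (1 / α)) ^ (k + 1)) ((C₂ * A ^ (k + 1)) ^ (1 / α))), le_max_left _ _,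
    fun h h0 h1 U hU hUT l π hπ r hr1 hr => ?_⟩
  set t : Fin (k + 1) → ℝ := fun i => U (π i) l with ht
  set lo : Fin (k + 1) → ℝ := Fin.cons 0 fun i : Fin k => t i.castSucc with hlo
  set ρ : Fin (k + 1) → ℝ := Fin.cons 1 r with hρ
  set g : Fin (k + 1) → (Fin N → ℝ) → ℝ := fun i => kernelG N α h (U (π i)) with hg
  set S : Fin (k + 1) → Set (Fin N → ℝ) := fun i => strip ε l (lo i) (t i) with hS
  have hUpos : ∀ j l, 0 < U j l := fun j l => hε.trans_le (hU j l)
  have hUR : ∀ j l, U j l ≤ R := fun j l => (hUT j l).trans (le_max_left _ _)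
  have hlo0 : ∀ i, 0 ≤ lo i := fun i => by
    refine Fin.cases (by simp [hlo]) (fun i => ?_) i
    simpa [hlo, ht] using (hUpos _ l).le
  have hlot : ∀ i, lo i < t i := fun i => by
    refine Fin.cases (by simpa [hlo, ht] using hUpos _ l) (fun i => ?_) i
    simpa [hlo] using hπ (Fin.castSucc_lt_succ (i := i))
  have htlo : ∀ i j, j < i → t j ≤ lo i := fun i => by
    refine Fin.cases (fun j hj => (Fin.not_lt_zero j hj).elim) (fun i j hj => ?_) i
    simpa [hlo] using hπ.monotone (Fin.le_castSucc_iff.2 hj)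
  have hρ1 : ∀ i, 1 ≤ ρ i := fun i => by
    refine Fin.cases (by simp [hρ]) (fun i => ?_) i
    simpa [hρ] using hr1 i
  have hρprod : ∏ i, ρ i = ∏ i, r i := by simp [hρ, Fin.prod_univ_succ]
  have hgm : ∀ j, Measurable (g j) := fun j => measurable_kernelG N α h _
  have hgi : ∀ j, Integrable fun w => |g j w| ^ α := fun j =>
    integrable_abs_kernelG_rpow hα0 hα2 (fun l => h0 l _) (fun l => h1 l _) (hUpos _)
  have hSm : ∀ i, MeasurableSet (S i) := fun i => measurableSet_strip _ _ _ _
  have hzero : ∀ i j, j < i → ∀ w ∈ S i, g j w = 0 := fun i j hij w hw =>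
    have := lt_of_mem_strip hw
    kernelG_eq_zero ((hlo0 i).trans this.1.le) ((htlo i j hij).trans this.1.le)
  have hupper : ∀ i j, i < j → ∫ w in S i, |g j w| ^ α ≤ (R ^ 2) ^ N := fun i j hij =>
    setIntegral_strip_le hα0 hα2 (fun l => h0 l _) (fun l => h1 l _) hε hR (hU _) (hUR _)
      (hlo0 i) (hlot i) (hπ hij).le
  have hB1 : ∀ i, 1 ≤ A * ρ i ^ α := fun i =>
    one_le_mul_of_one_le_of_one_le hA1 (Real.one_le_rpow (hρ1 i) hα0.le)
  have hlower : ∀ i, 1 ≤ A * ρ i ^ α * ∫ w in S i, |g i w| ^ α := by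
    intro i
    have hstrip := le_setIntegral_strip (a := lo i) (u := U (π i)) (l := l) hα0 hα2
      (fun l => h0 l _) (fun l => h1 l _) hε hR (hU _) (hUR _) (hlo0 i) (hlot i)
    have hx : 0 < t i - lo i := sub_pos.2 (hlot i)
    have hxρ : e ^ 2 ≤ ρ i ^ α * (t i - lo i) ^ (α * h l (U (π i))) := by
      revert hx
      refine Fin.cases (fun hx => ?_) (fun i hx => ?_) i
      · simp only [hlo, hρ, Fin.cons_zero, sub_zero, Real.one_rpow, one_mul]
        calc e ^ 2 = e ^ (2 : ℝ) := by norm_cast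
          _ ≤ e ^ (α * h l (U (π 0))) := Real.rpow_le_rpow_of_exponent_ge he he1
              (by nlinarith [h0 l (U (π 0)), h1 l (U (π 0))])
          _ ≤ _ := Real.rpow_le_rpow he.le
              ((min_le_left _ _).trans (by linarith [hU (π 0) l]))
              (mul_nonneg hα0.le (h0 l _).le)
      · simp only [hlo, hρ, Fin.cons_succ] at hx ⊢
        have h2 := hr i
        change (t i.succ - t i.castSucc) ^ (-h l (U (π i.succ))) ≤ r i at h2
        have h3 : 1 ≤ r i * (t i.succ - t i.castSucc) ^ h l (U (π i.succ)) := by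
          rw [Real.rpow_neg hx.le] at h2
          rwa [← div_le_iff₀ (by positivity), one_div]
        have hri : 0 ≤ r i := zero_le_one.trans (hr1 i)
        calc e ^ 2 ≤ 1 := pow_le_one₀ he.le he1
          _ ≤ (r i * (t i.succ - t i.castSucc) ^ h l (U (π i.succ))) ^ α :=
              Real.one_le_rpow h3 hα0.le
          _ = _ := by
              rw [Real.mul_rpow hri (by positivity), ← Real.rpow_mul hx.le, mul_comm α]
    have hρi := zero_le_one.trans (hρ1 i)
    calc (1 : ℝ) = A * (e ^ 2 * c) := by rw [hAdef]; field_simp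
      _ ≤ A * (ρ i ^ α * (t i - lo i) ^ (α * h l (U (π i))) * c) := by gcongr
      _ = A * ρ i ^ α * ((t i - lo i) ^ (α * h l (U (π i))) * c) := by ring
      _ ≤ _ := by gcongr
  have hWint : ∀ v : Fin (k + 1) → ℝ, Integrable fun w => |∑ j, v j * g j w| ^ α := fun v =>
    integrable_abs_sum_rpow hα0 hα2 hgm hgi v
  have hsumperm : ∀ (v : Fin (k + 1) → ℝ) w,
      ∑ j, v j * kernelG N α h (U j) w = ∑ i, v (π i) * g i w := fun v w =>
    (Equiv.sum_comp π fun j => v j * kernelG N α h (U j) w).symm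
  simp only [hsumperm]
  have hdisj : Pairwise (Function.onFun Disjoint S) := by
    have key : ∀ i j, i < j → Disjoint (S i) (S j) := fun i j hij =>
      Set.disjoint_left.2 fun w hw hw' => by
        have h2 := (lt_of_mem_strip hw).2
        have h3 := (lt_of_mem_strip hw').1
        linarith [htlo j i hij, hlot i]
    intro i j hij
    rcases lt_or_gt_of_ne hij with h' | h'
    · exact key i j h'
    · exact (key j i h').symm
  constructor
  · rw [lintegral_comp_perm π fun v => ENNReal.ofReal
      (Real.exp (-(1 / 2) * ∫ w, |∑ i, v i * g i w| ^ α))]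
    have hl := hlap (k + 1) g S (fun i => (A * ρ i ^ α)⁻¹) hgm hgi hSm hzero
      (fun i => inv_pos.2 (zero_lt_one.trans_le (hB1 i)))
      (fun i => by
        rw [inv_le_iff_one_le_mul₀' (zero_lt_one.trans_le (hB1 i))]
        exact hlower i)
    refine (lintegral_mono fun v => ENNReal.ofReal_le_ofReal (Real.exp_le_exp.2 ?_)).trans
      (hl.trans (ENNReal.ofReal_le_ofReal ?_))
    · have h2 : ∑ i, ∫ w in S i, |∑ j, v j * g j w| ^ α ≤ ∫ w, |∑ j, v j * g j w| ^ α := by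
        rw [← integral_iUnion_fintype hSm hdisj fun i => (hWint v).integrableOn]
        exact setIntegral_le_integral (hWint v) (.of_forall fun w => by positivity)
      linarith
    · have h3 : ∀ i, C₁ * (A * ρ i ^ α)⁻¹ ^ (-1 / α) = C₁ * A ^ (1 / α) * ρ i := fun i => by
        have hρi := zero_le_one.trans (hρ1 i)
        rw [neg_div, Real.rpow_neg (by positivity), Real.inv_rpow (by positivity), inv_inv,
          Real.mul_rpow hA0.le (by positivity), ← Real.rpow_mul hρi, mul_one_div_cancel hα0.ne',
          Real.rpow_one, mul_assoc]
      simp only [h3]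
      rw [Finset.prod_mul_distrib, hρprod]
      simp only [prod_const, card_univ, Fintype.card_fin]
      have := prod_nonneg fun i (_ : i ∈ univ) => zero_le_one.trans (hr1 i)
      gcongr
      exact (le_max_left _ _).trans (le_max_right _ _)
  · intro v j
    set W := ∫ w, |∑ i, v (π i) * g i w| ^ α with hW
    have hW0 : 0 ≤ W := integral_nonneg fun w => by positivity
    have h2 := hcoef g S (fun i => A * ρ i ^ α) hgm hgi hSm hzero hB1 hlower hupper
      (fun i => v (π i)) W (fun i => setIntegral_le_integral (hWint _)
        (.of_forall fun w => by positivity)) (π.symm j)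
    have hrp : 0 ≤ ∏ i, r i := prod_nonneg fun i (_ : i ∈ univ) => zero_le_one.trans (hr1 i)
    rw [Equiv.apply_symm_apply, Finset.prod_mul_distrib,
      Real.finsetProd_rpow _ _ fun i _ => zero_le_one.trans (hρ1 i), hρprod] at h2
    simp only [prod_const, card_univ, Fintype.card_fin] at h2
    have h3 := Real.rpow_le_rpow (by positivity) h2 hα'.le
    rw [← Real.rpow_mul (abs_nonneg _), mul_one_div_cancel hα0.ne', Real.rpow_one,
      ← mul_assoc, Real.mul_rpow (by positivity) hW0, Real.mul_rpow (by positivity) (by positivity),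
      ← Real.rpow_mul hrp, mul_one_div_cancel hα0.ne', Real.rpow_one] at h3
    refine h3.trans ?_
    gcongr
    exact (le_max_right _ _).trans (le_max_right _ _)

lemma lintegral_pi_prod {n : ℕ} {E : Type*} [MeasurableSpace E] (μ : Fin n → Measure E)
    [∀ i, SigmaFinite (μ i)] {f : Fin n → E → ℝ≥0∞} (hf : ∀ i, Measurable (f i)) :
    ∫⁻ x, ∏ i, f i (x i) ∂Measure.pi μ = ∏ i, ∫⁻ x, f i x ∂μ i := by
  induction n with
  | zero => simp
  | succ n ih =>
    have hmp := (measurePreserving_piFinSuccAbove μ 0).symm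
    rw [← hmp.lintegral_comp_emb (MeasurableEquiv.measurableEmbedding _)]
    simp only [MeasurableEquiv.piFinSuccAbove_symm_apply, Fin.insertNthEquiv_apply,
      Fin.insertNth_zero', Fin.prod_univ_succ, Fin.cons_zero, Fin.cons_succ, Fin.succAbove_zero]
    rw [lintegral_prod_mul (f := f 0) (g := fun y : Fin n → E => ∏ i, f i.succ (y i))
      (hf 0).aemeasurable
      (Finset.measurable_prod _ fun i _ => (hf _).comp (measurable_pi_apply i)).aemeasurable,
      ih (fun i => μ i.succ) fun i => hf i.succ]

lemma volume_measurePreserving_pi_swap (n N : ℕ) :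
    MeasurePreserving fun (v : Fin n → Fin N → ℝ) (l : Fin N) (j : Fin n) => v j l := by
  refine ⟨by fun_prop, ?_⟩
  symm
  rw [volume_pi]
  refine Measure.pi_eq_generateFrom
    (C := fun _ => Set.pi Set.univ '' Set.pi Set.univ fun _ : Fin n => {s : Set ℝ | MeasurableSet s})
    (fun _ => generateFrom_pi) (fun _ => isPiSystem_pi)
    (fun _ => Measure.FiniteSpanningSetsIn.pi fun _ =>
      (volume : Measure ℝ).toFiniteSpanningSetsIn) fun s hs => ?_
  choose B hB hBs using hs
  have hBm : ∀ l j, MeasurableSet (B l j) := fun l j => hB l j (Set.mem_univ j)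
  rw [Measure.map_apply (by fun_prop)
    (MeasurableSet.univ_pi fun l => by rw [← hBs l]; exact .univ_pi (hBm l))]
  have : (fun (v : Fin n → Fin N → ℝ) (l : Fin N) (j : Fin n) => v j l) ⁻¹' Set.univ.pi s =
      Set.univ.pi fun j => Set.univ.pi fun l => B l j := by
    ext v
    simp only [← hBs, Set.mem_preimage, Set.mem_univ_pi]
    exact forall_comm
  rw [this]
  simp only [← hBs, volume_pi_pi, Measure.pi_pi]
  exact Finset.prod_comm (f := fun j l => volume (B l j))

lemma lintegral_pi_swap (n N : ℕ) (f : (Fin N → Fin n → ℝ) → ℝ≥0∞) :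
    ∫⁻ v : Fin n → Fin N → ℝ, f (fun l j => v j l) = ∫⁻ v : Fin N → Fin n → ℝ, f v := by
  let e : (Fin n → Fin N → ℝ) ≃ᵐ (Fin N → Fin n → ℝ) :=
    { toFun := fun v l j => v j l
      invFun := fun v j l => v l j
      left_inv := fun _ => rfl
      right_inv := fun _ => rfl
      measurable_toFun := by dsimp; fun_prop
      measurable_invFun := by dsimp; fun_prop }
  exact (volume_measurePreserving_pi_swap n N).lintegral_comp_emb e.measurableEmbedding f

/-- The integrable singularity carried by a gap of length `z` in an interval of length `δ`. -/
noncomputable def gapWeight (q δ z : ℝ) : ℝ≥0∞ :=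
  (Set.Ioc 0 δ).indicator (fun z => ENNReal.ofReal ((z / δ) ^ (-q))) z

lemma measurable_gapWeight (q δ : ℝ) : Measurable (gapWeight q δ) :=
  Measurable.indicator (by fun_prop) measurableSet_Ioc

lemma lintegral_gapWeight {q δ : ℝ} (hq : q < 1) (hδ : 0 < δ) :
    ∫⁻ z, gapWeight q δ z = ENNReal.ofReal (δ / (1 - q)) := by
  unfold gapWeight
  rw [lintegral_indicator measurableSet_Ioc]
  have hint : IntervalIntegrable (fun z : ℝ => z ^ (-q)) volume 0 δ :=
    intervalIntegral.intervalIntegrable_rpow' (by linarith)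
  have heq : ∀ z ∈ Set.Ioc 0 δ, (z / δ) ^ (-q) = δ ^ q * z ^ (-q) := fun z hz => by
    rw [Real.div_rpow hz.1.le hδ.le, Real.rpow_neg hδ.le, div_inv_eq_mul, mul_comm]
  rw [setLIntegral_congr_fun measurableSet_Ioc fun z hz => congrArg ENNReal.ofReal (heq z hz),
    ← ofReal_integral_eq_lintegral_ofReal]
  · rw [integral_const_mul, ← intervalIntegral.integral_of_le hδ.le,
      integral_rpow (Or.inl (by linarith)), Real.zero_rpow (by linarith), sub_zero,
      Real.rpow_add hδ, Real.rpow_one, Real.rpow_neg hδ.le]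
    congr 1
    have := (Real.rpow_pos_of_pos hδ q).ne'
    rw [show -q + 1 = 1 - q by ring]
    field_simp
  · exact ((intervalIntegrable_iff_integrableOn_Ioc_of_le hδ.le).1 hint).const_mul _
  · exact (ae_restrict_mem measurableSet_Ioc).mono fun z hz => by
      have := hz.1
      dsimp only
      positivity

/-- The product of the gap weights, summed over all orderings of the points. -/
noncomputable def chainWeight (k : ℕ) (q δ : ℝ) (t : Fin (k + 1) → ℝ) : ℝ≥0∞ :=
  ∑ π : Equiv.Perm (Fin (k + 1)), ∏ i : Fin k, gapWeight q δ (t (π i.succ) - t (π i.castSucc))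

lemma measurable_chainWeight (k : ℕ) (q δ : ℝ) : Measurable (chainWeight k q δ) := by
  refine Finset.measurable_sum _ fun π _ => Finset.measurable_prod _ fun i _ => ?_
  exact (measurable_gapWeight q δ).comp (by fun_prop)

lemma lintegral_ordered_chain_le {q δ : ℝ} (hq : q < 1) (hδ : 0 < δ) (a : ℝ) (k : ℕ) :
    ∫⁻ t : Fin (k + 1) → ℝ, (Set.Icc a (a + δ)).indicator 1 (t (Fin.last k)) *
        ∏ i : Fin k, gapWeight q δ (t i.succ - t i.castSucc) =
      ENNReal.ofReal δ * ENNReal.ofReal (δ / (1 - q)) ^ k := by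
  induction k with
  | zero =>
    have hmp := (volume_preserving_funUnique (Fin 1) ℝ)
    have h2 := hmp.lintegral_comp_emb (MeasurableEquiv.measurableEmbedding _)
      ((Set.Icc a (a + δ)).indicator 1)
    simp only [univ_eq_empty, prod_empty, mul_one, pow_zero]
    refine Eq.trans ?_ (h2.trans ?_)
    · rfl
    · simp [lintegral_indicator]
  | succ k ih =>
    have hmp := (volume_preserving_piFinSuccAbove (fun _ : Fin (k + 2) => ℝ) 0).symm
    rw [← hmp.lintegral_comp_emb (MeasurableEquiv.measurableEmbedding _)]
    have hind : Measurable ((Set.Icc a (a + δ)).indicator (1 : ℝ → ℝ≥0∞)) :=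
      measurable_one.indicator measurableSet_Icc
    have hgm := measurable_gapWeight q δ
    simp only [MeasurableEquiv.piFinSuccAbove_symm_apply, Fin.insertNthEquiv_apply,
      Fin.insertNth_zero', Fin.prod_univ_succ, Fin.cons_succ,
      ← Fin.succ_last, Fin.castSucc_zero, Fin.cons_zero, ← Fin.succ_castSucc]
    rw [Measure.volume_eq_prod, lintegral_prod_symm _ (by fun_prop)]
    calc _ = ∫⁻ t : Fin (k + 1) → ℝ, ENNReal.ofReal (δ / (1 - q)) *
          ((Set.Icc a (a + δ)).indicator 1 (t (Fin.last k)) *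
            ∏ i : Fin k, gapWeight q δ (t i.succ - t i.castSucc)) := by
          refine lintegral_congr fun t => ?_
          rw [← lintegral_gapWeight hq hδ, ← lintegral_sub_left_eq_self (gapWeight q δ) (t 0),
            ← lintegral_mul_const _ (by fun_prop)]
          refine lintegral_congr fun x => ?_
          ring
      _ = _ := by
          rw [lintegral_const_mul _ (by fun_prop), ih]
          ring

lemma setLIntegral_chainWeight_le {q δ : ℝ} (hq : q < 1) (hδ : 0 < δ) (a : ℝ) (k : ℕ) :
    ∫⁻ t in Set.univ.pi fun _ : Fin (k + 1) => Set.Icc a (a + δ), chainWeight k q δ t ≤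
      ENNReal.ofReal ((k + 1).factorial * (1 / (1 - q)) ^ k * δ ^ (k + 1)) := by
  unfold chainWeight
  have hgm := measurable_gapWeight q δ
  rw [lintegral_finsetSum _ fun π _ => by fun_prop]
  have key : ∀ π : Equiv.Perm (Fin (k + 1)),
      ∫⁻ t in Set.univ.pi fun _ : Fin (k + 1) => Set.Icc a (a + δ),
        ∏ i : Fin k, gapWeight q δ (t (π i.succ) - t (π i.castSucc)) ≤
      ENNReal.ofReal δ * ENNReal.ofReal (δ / (1 - q)) ^ k := fun π => by
    rw [← lintegral_ordered_chain_le hq hδ a k, ← lintegral_comp_perm π,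
      ← lintegral_indicator (MeasurableSet.univ_pi fun _ => measurableSet_Icc)]
    refine lintegral_mono fun t => ?_
    by_cases ht : t ∈ Set.univ.pi fun _ : Fin (k + 1) => Set.Icc a (a + δ)
    · rw [Set.indicator_of_mem ht, Set.indicator_of_mem (ht _ (Set.mem_univ _))]
      simp
    · rw [Set.indicator_of_notMem ht]
      exact zero_le
  refine (Finset.sum_le_sum fun π _ => key π).trans (le_of_eq ?_)
  have h1 : 0 < 1 - q := by linarith
  rw [sum_const, card_univ, Fintype.card_perm, Fintype.card_fin, nsmul_eq_mul,
    ← ENNReal.ofReal_pow (by positivity), ← ENNReal.ofReal_mul hδ.le,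
    ← ENNReal.ofReal_natCast, ← ENNReal.ofReal_mul (by positivity)]
  congr 1
  rw [div_pow, div_pow]
  field_simp
  ring

lemma ofReal_prod_gap_le_chainWeight {k : ℕ} {q δ a : ℝ} {t : Fin (k + 1) → ℝ}
    (ht : ∀ j, t j ∈ Set.Icc a (a + δ)) {π : Equiv.Perm (Fin (k + 1))}
    (hπ : StrictMono fun i => t (π i)) :
    ENNReal.ofReal (∏ i : Fin k, ((t (π i.succ) - t (π i.castSucc)) / δ) ^ (-q)) ≤
      chainWeight k q δ t := by
  have hgap : ∀ i : Fin k, t (π i.succ) - t (π i.castSucc) ∈ Set.Ioc 0 δ := fun i =>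
    ⟨sub_pos.2 (hπ (Fin.castSucc_lt_succ (i := i))),
      by linarith [(ht (π i.succ)).2, (ht (π i.castSucc)).1]⟩
  rw [ENNReal.ofReal_prod_of_nonneg fun i _ => Real.rpow_nonneg
    (div_nonneg (hgap i).1.le ((hgap i).1.le.trans (hgap i).2)) _]
  calc _ = ∏ i : Fin k, gapWeight q δ (t (π i.succ) - t (π i.castSucc)) :=
        Finset.prod_congr rfl fun i _ => by rw [gapWeight, Set.indicator_of_mem (hgap i)]
    _ ≤ _ := Finset.single_le_sum (f := fun π : Equiv.Perm (Fin (k + 1)) =>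
        ∏ i : Fin k, gapWeight q δ (t (π i.succ) - t (π i.castSucc)))
        (fun _ _ => zero_le) (mem_univ π)

lemma setLIntegral_prod_chainWeight_le {q δ : ℝ} (hq : q < 1) (hδ : 0 < δ) {N : ℕ}
    (a : Fin N → ℝ) (k : ℕ) :
    ∫⁻ U in {U : Fin (k + 1) → Fin N → ℝ | ∀ j, U j ∈ Set.Icc a fun l => a l + δ},
        ∏ l, chainWeight k q δ (fun j => U j l) ≤
      ENNReal.ofReal (((k + 1).factorial * (1 / (1 - q)) ^ k * δ ^ (k + 1)) ^ N) := by
  have hset : {U : Fin (k + 1) → Fin N → ℝ | ∀ j, U j ∈ Set.Icc a fun l => a l + δ} =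
      (fun (v : Fin (k + 1) → Fin N → ℝ) (l : Fin N) (j : Fin (k + 1)) => v j l) ⁻¹'
        Set.univ.pi fun l => Set.univ.pi fun _ => Set.Icc (a l) (a l + δ) := by
    ext U
    simp only [Set.mem_ofPred_eq, Set.mem_preimage, Set.mem_univ_pi, Set.mem_Icc, Pi.le_def,
      ← forall_and]
    exact forall_comm
  have hm : MeasurableSet (Set.univ.pi fun l : Fin N =>
      Set.univ.pi fun _ : Fin (k + 1) => Set.Icc (a l) (a l + δ)) :=
    .univ_pi fun _ => .univ_pi fun _ => measurableSet_Icc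
  rw [hset, ← lintegral_indicator (hm.preimage (by fun_prop))]
  refine (lintegral_pi_swap (k + 1) N ((Set.univ.pi fun l : Fin N =>
      Set.univ.pi fun _ : Fin (k + 1) => Set.Icc (a l) (a l + δ)).indicator
        fun t => ∏ l, chainWeight k q δ (t l))).trans_le ?_
  rw [lintegral_indicator hm, volume_pi, Measure.restrict_pi_pi,
    lintegral_pi_prod _ fun _ => measurable_chainWeight k q δ]
  have h1 : 0 < 1 - q := by linarith
  rw [ENNReal.ofReal_pow (by positivity)]
  refine (Finset.prod_le_prod' fun l _ => setLIntegral_chainWeight_le hq hδ (a l) k).trans_eq ?_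
  simp

lemma ae_injective_coordinates (n N : ℕ) :
    ∀ᵐ U : Fin n → Fin N → ℝ, ∀ l, Function.Injective fun j => U j l := by
  have key : ∀ l (i j : Fin n), i ≠ j → ∀ᵐ U : Fin n → Fin N → ℝ, U i l ≠ U j l := by
    intro l i j hij
    let φ : (Fin n → Fin N → ℝ) →ₗ[ℝ] ℝ :=
      { toFun := fun U => U i l - U j l
        map_add' := fun U V => by simp; ring
        map_smul' := fun c U => by simp; ring }
    have hφ : LinearMap.ker φ ≠ ⊤ := fun htop => by
      have h1 : φ (Pi.single i fun _ => 1) = 0 := by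
        rw [← LinearMap.mem_ker, htop]; trivial
      simp [φ, hij.symm] at h1
    have h2 := Measure.addHaar_submodule volume _ hφ
    rw [ae_iff]
    refine measure_mono_null (fun U hU => ?_) h2
    simp only [ne_eq, not_not, Set.mem_ofPred_eq] at hU
    simp [φ, hU]
  simp only [← ae_all_iff] at key
  filter_upwards [key] with U hU l i j hij
  by_contra hne
  exact hU l i j hne hij

lemma exists_perm_strictMono {n : ℕ} {t : Fin n → ℝ} (ht : Function.Injective t) :
    ∃ π : Equiv.Perm (Fin n), StrictMono fun i => t (π i) :=
  ⟨Tuple.sort t, (Tuple.monotone_sort t).strictMono_of_injective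
    (ht.comp (Tuple.sort t).injective)⟩

lemma norm_exp_neg_mul_I_sub_le {a b κ : ℝ} (hκ0 : 0 < κ) (hκ1 : κ ≤ 1) :
    ‖Complex.exp (-(a : ℂ) * Complex.I) - Complex.exp (-(b : ℂ) * Complex.I)‖ ≤
      2 * |a - b| ^ κ := by
  have h1 : ∀ c : ℝ, ‖Complex.exp (-(c : ℂ) * Complex.I)‖ = 1 := fun c => by
    rw [← Complex.ofReal_neg, Complex.norm_exp_ofReal_mul_I]
  rcases le_total 1 |a - b| with h | h
  · have h2 := norm_sub_le (Complex.exp (-(a : ℂ) * Complex.I))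
      (Complex.exp (-(b : ℂ) * Complex.I))
    rw [h1, h1] at h2
    have := Real.one_le_rpow h hκ0.le
    linarith
  · have h2 : Complex.exp (-(a : ℂ) * Complex.I) - Complex.exp (-(b : ℂ) * Complex.I) =
        Complex.exp (-(b : ℂ) * Complex.I) * (Complex.exp (Complex.I * ((b - a : ℝ) : ℂ)) - 1) := by
      rw [mul_sub, ← Complex.exp_add, mul_one]
      congr 2
      push_cast
      ring
    rw [h2, norm_mul, h1, one_mul]
    have h3 := Real.norm_exp_I_mul_ofReal_sub_one_le (x := b - a)
    rw [Real.norm_eq_abs, abs_sub_comm] at h3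
    have h4 : |a - b| ≤ |a - b| ^ κ := Real.self_le_rpow_of_le_one (abs_nonneg _) h hκ1
    have := abs_nonneg (a - b)
    linarith

lemma rpow_mul_exp_neg_le {y p : ℝ} (hy : 0 ≤ y) (hp : 0 < p) :
    y ^ p * Real.exp (-y) ≤ (2 * p) ^ p * Real.exp (-(1 / 2) * y) := by
  have h1 : y ≤ 2 * p * Real.exp (y / (2 * p)) := by
    have := Real.add_one_le_exp (y / (2 * p))
    have h2 : y = 2 * p * (y / (2 * p)) := by field_simp
    calc y = 2 * p * (y / (2 * p)) := h2
      _ ≤ _ := by gcongr; linarith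
  have h2 := Real.rpow_le_rpow hy h1 hp.le
  rw [Real.mul_rpow (by positivity) (by positivity), ← Real.exp_mul] at h2
  calc _ ≤ (2 * p) ^ p * Real.exp (y / (2 * p) * p) * Real.exp (-y) := by gcongr
    _ = _ := by
      rw [mul_assoc, ← Real.exp_add]
      congr 2
      field_simp
      ring

lemma lintegral_prod_coordinates {n d : ℕ} {F : (Fin n → ℝ) → ℝ≥0∞} (hF : Measurable F) :
    ∫⁻ V : Fin n → EuclideanSpace ℝ (Fin d), ∏ k, F (fun j => V j k) =
      (∫⁻ v, F v) ^ d := by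
  have hmp : MeasurePreserving fun (V : Fin n → EuclideanSpace ℝ (Fin d)) j =>
      (WithLp.ofLp (V j) : Fin d → ℝ) :=
    volume_preserving_pi fun _ => PiLp.volume_preserving_ofLp (Fin d)
  have h1 := hmp.lintegral_comp (f := fun V => ∏ k, F (fun j => V j k)) (by fun_prop)
  refine h1.trans ((lintegral_pi_swap n d fun v => ∏ k, F (v k)).trans ?_)
  rw [volume_pi, lintegral_pi_prod _ fun _ => hF]
  simp

lemma abs_sum_mul_sub_le {d : ℕ} (v : Fin d → ℝ) (x y : EuclideanSpace ℝ (Fin d)) :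
    |∑ k, v k * x k - ∑ k, v k * y k| ≤ ‖x - y‖ * ∑ k, |v k| := by
  rw [← Finset.sum_sub_distrib, Finset.mul_sum]
  refine (Finset.abs_sum_le_sum_abs _ _).trans (Finset.sum_le_sum fun k _ => ?_)
  rw [← mul_sub, abs_mul, mul_comm]
  gcongr
  exact PiLp.norm_apply_le (x - y) k

/-- The spatial integral is controlled by a coefficient bound and a one-dimensional Laplace
integral. -/
lemma lintegral_enorm_increments_mul_exp_le {n d : ℕ} {α κ A : ℝ} (hn : n ≠ 0)
    (hκ0 : 0 < κ) (hκ1 : κ ≤ 1) (hA : 0 ≤ A) (hα0 : 0 < α) {W : (Fin n → ℝ) → ℝ} (hW : Measurable W)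
    (hW0 : ∀ v, 0 ≤ W v) (hAW : ∀ v j, |v j| ≤ A * W v ^ (1 / α))
    (x y : EuclideanSpace ℝ (Fin d)) :
    ∫⁻ V : Fin n → EuclideanSpace ℝ (Fin d),
      ‖(∏ j, (Complex.exp (-((∑ k, V j k * x k : ℝ) : ℂ) * Complex.I) -
               Complex.exp (-((∑ k, V j k * y k : ℝ) : ℂ) * Complex.I))) *
          Complex.exp (-((∑ k : Fin d, W (fun j => V j k) : ℝ) : ℂ))‖ₑ ≤
      ENNReal.ofReal (2 ^ n * (d * A * ‖x - y‖) ^ (n * κ) *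
        (2 * (n * κ / α)) ^ (n * κ / α)) *
      (∫⁻ v, ENNReal.ofReal (Real.exp (-(1 / 2) * W v))) ^ d := by
  rw [← lintegral_prod_coordinates (by fun_prop), ← lintegral_const_mul' _ _ ENNReal.ofReal_ne_top]
  refine lintegral_mono fun V => ?_
  have hnpos : (0 : ℝ) < n := by positivity
  set S := ∑ k : Fin d, W (fun j => V j k) with hS
  have hS0 : 0 ≤ S := Finset.sum_nonneg fun k _ => hW0 _
  rw [← ofReal_norm, ← ENNReal.ofReal_prod_of_nonneg fun k _ => (Real.exp_pos _).le,
    ← ENNReal.ofReal_mul (by positivity), ← Real.exp_sum, ← Finset.mul_sum, ← hS]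
  refine ENNReal.ofReal_le_ofReal ?_
  rw [norm_mul, norm_prod, ← Complex.ofReal_neg, Complex.norm_exp_ofReal]
  have hterm : ∀ j, ‖Complex.exp (-((∑ k, V j k * x k : ℝ) : ℂ) * Complex.I) -
      Complex.exp (-((∑ k, V j k * y k : ℝ) : ℂ) * Complex.I)‖ ≤
        2 * (d * A * ‖x - y‖ * S ^ (1 / α)) ^ κ := fun j => by
    refine (norm_exp_neg_mul_I_sub_le hκ0 hκ1).trans ?_
    gcongr
    refine (abs_sum_mul_sub_le _ x y).trans ?_
    have : ∑ k, |V j k| ≤ ∑ _k : Fin d, A * S ^ (1 / α) := Finset.sum_le_sum fun k _ => by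
      refine (hAW (fun j => V j k) j).trans ?_
      have := Finset.single_le_sum (f := fun k => W (fun j => V j k)) (fun k _ => hW0 _) (mem_univ k)
      have h0 := hW0 fun j => V j k
      gcongr
    rw [sum_const, card_univ, Fintype.card_fin, nsmul_eq_mul] at this
    calc _ ≤ ‖x - y‖ * (d * (A * S ^ (1 / α))) := by gcongr
      _ = _ := by ring
  have hprod := Finset.prod_le_prod (fun j (_ : j ∈ univ) => norm_nonneg _) fun j _ => hterm j
  rw [prod_const, card_univ, Fintype.card_fin, mul_pow, ← Real.rpow_mul_natCast (by positivity),
    Real.mul_rpow (by positivity) (by positivity), ← Real.rpow_mul hS0] at hprod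
  have hexp := rpow_mul_exp_neg_le hS0 (show 0 < n * κ / α by positivity)
  have hb : 0 ≤ (d * A * ‖x - y‖) ^ (n * κ) := by positivity
  calc _ ≤ 2 ^ n * ((d * A * ‖x - y‖) ^ (κ * n) * S ^ (1 / α * (κ * n))) * Real.exp (-S) := by
        gcongr
    _ = 2 ^ n * (d * A * ‖x - y‖) ^ (n * κ) * (S ^ (n * κ / α) * Real.exp (-S)) := by
        rw [mul_comm κ, show 1 / α * (n * κ) = n * κ / α by ring]; ring
    _ ≤ 2 ^ n * (d * A * ‖x - y‖) ^ (n * κ) * ((2 * (n * κ / α)) ^ (n * κ / α) *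
          Real.exp (-(1 / 2) * S)) := by gcongr
    _ = _ := by ring

lemma rpow_neg_gap_le {s δ η h H D Δ : ℝ} (hs : 0 < s) (hsδ : s ≤ δ) (hδ1 : δ ≤ 1) (hη : 0 < η)
    (hD : 0 ≤ D) (hh : |h - H| ≤ D * δ ^ η) (hΔ : D * δ ^ η ≤ Δ) :
    s ^ (-h) ≤ Real.exp (D / η) * δ ^ (-H) * (s / δ) ^ (-(H + Δ)) := by
  have hδ : 0 < δ := hs.trans_le hsδ
  have h1 : s ^ (-h) = δ ^ (-h) * (s / δ) ^ (-h) := by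
    rw [← Real.mul_rpow hδ.le (by positivity), mul_div_cancel₀ _ hδ.ne']
  have h2 : (s / δ) ^ (-h) ≤ (s / δ) ^ (-(H + Δ)) :=
    Real.rpow_le_rpow_of_exponent_ge (by positivity) ((div_le_one hδ).2 hsδ)
      (by linarith [(abs_le.1 hh).2])
  have h3 : δ ^ (-h) ≤ Real.exp (D / η) * δ ^ (-H) := by
    have hlog := Real.log_le_rpow_div (x := δ⁻¹) (by positivity) hη
    rw [Real.log_inv, Real.inv_rpow hδ.le] at hlog
    rw [Real.rpow_def_of_pos hδ, Real.rpow_def_of_pos hδ, ← Real.exp_add]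
    refine Real.exp_le_exp.2 ?_
    have hl0 : 0 ≤ -Real.log δ := by linarith [Real.log_nonpos hδ.le hδ1]
    have h5 : -Real.log δ * (h - H) ≤ -Real.log δ * (D * δ ^ η) :=
      mul_le_mul_of_nonneg_left ((le_abs_self _).trans hh) hl0
    have h6 : -Real.log δ * (D * δ ^ η) ≤ (δ ^ η)⁻¹ / η * (D * δ ^ η) :=
      mul_le_mul_of_nonneg_right hlog (by positivity)
    have h7 : (δ ^ η)⁻¹ / η * (D * δ ^ η) = D / η := by
      have : δ ^ η ≠ 0 := (Real.rpow_pos_of_pos hδ η).ne'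
      field_simp
    linarith
  rw [h1]
  gcongr

/-- Choice of interpolation exponents adapted to the index `γ_σ`. -/
lemma exists_interpolation_exponents {N d : ℕ} {h : Fin N → (Fin N → ℝ) → ℝ}
    {v : Fin N → ℝ} {σ : Equiv.Perm (Fin N)} {m₀ η p : ℝ} (hm₀ : 0 < m₀)
    (hm : ∀ l, m₀ ≤ h l v) (h1 : ∀ l, h l v < 1) (hdN : (d : ℝ) < ∑ l, 1 / h l v) {k : ℕ}
    (hp : 0 < p) (hη0 : 0 ≤ η) (hη1 : η ≤ 1) (hηp : η * (N / m₀) ≤ p / 2) (hηk : k * η ≤ m₀)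
    (hpα : p < alphaFn N d h σ v / (2 * gammaIdx N d h σ v)) :
    ∃ (P : Fin N → ℝ) (l₀ : Fin N), (∀ l, 0 ≤ P l) ∧ ∑ l, P l = d ∧
      hGamma N d h σ v = h l₀ v ∧
      (∀ l, h l v * (P l + if l = l₀ then p else 0) ≤ 1 - min η (m₀ * p / 2)) ∧
      k * ∑ l, h l v * P l ≤ (k + 1) * (N - betaFn N d h σ v) := by
  set Γ : Set ℕ := {mm : ℕ |
    (d : ℝ) < ∑ l ∈ Finset.univ.filter (fun l : Fin N => (l : ℕ) < mm), 1 / h (σ l) v} with hΓ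
  set γ := gammaIdx N d h σ v with hγdef
  have hγinf : γ = sInf Γ := rfl
  have hNmem : N ∈ Γ := by
    have : Finset.univ.filter (fun l : Fin N => (l : ℕ) < N) = univ := by
      ext l; simp
    simp only [hΓ, Set.mem_ofPred_eq, this]
    rwa [Equiv.sum_comp σ fun l => 1 / h l v]
  have hγmem : γ ∈ Γ := Nat.sInf_mem ⟨N, hNmem⟩
  have hγN : γ ≤ N := Nat.sInf_le hNmem
  have hγ1 : 1 ≤ γ := by
    rw [Nat.one_le_iff_ne_zero]
    intro h0
    rw [h0] at hγmem
    simp only [hΓ, Set.mem_ofPred_eq, not_lt_zero, Finset.filter_false, sum_empty] at hγmem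
    exact absurd hγmem (not_lt.2 (Nat.cast_nonneg d))
  have hγlt : γ - 1 < N := by omega
  set i₀ : Fin N := ⟨γ - 1, hγlt⟩ with hi₀
  set S := ∑ l ∈ Finset.univ.filter (fun l : Fin N => (l : ℕ) < γ - 1), 1 / h (σ l) v with hS
  have hSd : S ≤ d := by
    have : γ - 1 ∉ Γ := Nat.notMem_of_lt_sInf (by omega)
    simpa [hΓ, hS] using this
  have hfilter : Finset.univ.filter (fun l : Fin N => (l : ℕ) < γ) =
      insert i₀ (Finset.univ.filter (fun l : Fin N => (l : ℕ) < γ - 1)) := by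
    ext l
    simp only [mem_filter, mem_univ, true_and, mem_insert, hi₀, Fin.ext_iff]
    omega
  have hsplit : ∑ l ∈ Finset.univ.filter (fun l : Fin N => (l : ℕ) < γ), 1 / h (σ l) v =
      1 / h (σ i₀) v + S := by
    rw [hfilter, sum_insert (by simp [hi₀])]
  set G := h (σ i₀) v with hG
  have hGpos : 0 < G := hm₀.trans_le (hm _)
  have hpos : ∀ l, 0 < h l v := fun l => hm₀.trans_le (hm l)
  have hG1 : G < 1 := h1 _
  have hcard : #(Finset.univ.filter (fun l : Fin N => (l : ℕ) < γ - 1)) = γ - 1 := by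
    have := Fin.card_filter_val_lt (n := N) (m := γ - 1)
    rw [this]; omega
  have hSle : S ≤ ((γ : ℝ) - 1) / m₀ := by
    calc S ≤ ∑ l ∈ Finset.univ.filter (fun l : Fin N => (l : ℕ) < γ - 1), 1 / m₀ :=
          sum_le_sum fun l _ => one_div_le_one_div_of_le hm₀ (hm _)
      _ = _ := by
        rw [sum_const, hcard, nsmul_eq_mul, Nat.cast_sub hγ1, Nat.cast_one]; ring
  have hS0 : 0 ≤ S := sum_nonneg fun l _ => (one_div_pos.2 (hpos _)).le
  have hγ1' : (1 : ℝ) ≤ γ := by exact_mod_cast hγ1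
  have hγN' : (γ : ℝ) ≤ N := by exact_mod_cast hγN
  have hα : alphaFn N d h σ v = 1 / G + S - d := by
    rw [alphaFn, ← hγdef, hsplit]
  have hβ : betaFn N d h σ v = N - γ + G * (1 / G + S - d) := by
    rw [betaFn, dif_pos hγlt, ← hsplit]
  have hΓh : hGamma N d h σ v = G := by
    rw [hGamma, dif_pos hγlt]
  rw [hα, lt_div_iff₀ (by positivity)] at hpα
  have hdS : d - S ≤ 1 / G - 2 * p := by nlinarith
  let Q : Fin N → ℝ := fun i =>
    if (i : ℕ) < γ - 1 then (1 - η) / h (σ i) v else if i = i₀ then d - (1 - η) * S else 0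
  have hQ0 : ∀ i, 0 ≤ Q i := fun i => by
    dsimp only [Q]
    split_ifs
    · exact div_nonneg (by linarith) (hpos _).le
    · nlinarith
    · rfl
  have hi₀ne : ¬ ((i₀ : ℕ) < γ - 1) := by simp [hi₀]
  have hsumQ : ∀ F : Fin N → ℝ, ∑ i, F i * Q i =
      (1 - η) * ∑ l ∈ Finset.univ.filter (fun l : Fin N => (l : ℕ) < γ - 1), F l / h (σ l) v +
        F i₀ * (d - (1 - η) * S) := fun F => by
    rw [← Finset.sum_filter_add_sum_filter_not univ (fun l : Fin N => (l : ℕ) < γ - 1)]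
    congr 1
    · rw [Finset.mul_sum]
      refine sum_congr rfl fun i hi => ?_
      simp only [Q, if_pos (mem_filter.1 hi).2]
      ring
    · rw [Finset.sum_eq_single i₀]
      · simp [Q, hi₀ne]
      · intro i hi hne
        simp [Q, (mem_filter.1 hi).2, hne]
      · intro hni
        exact (hni (mem_filter.2 ⟨mem_univ i₀, hi₀ne⟩)).elim
  refine ⟨fun l => Q (σ.symm l), σ i₀, fun l => hQ0 _, ?_, hΓh, fun l => ?_, ?_⟩
  · rw [Equiv.sum_comp σ.symm Q]
    have := hsumQ fun _ => 1
    simp only [one_mul] at this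
    rw [this]
    ring
  · obtain ⟨i, rfl⟩ := σ.surjective l
    simp only [Equiv.symm_apply_apply, EmbeddingLike.apply_eq_iff_eq]
    by_cases hi : (i : ℕ) < γ - 1
    · have hne : i ≠ i₀ := fun h => hi₀ne (h ▸ hi)
      simp only [Q, if_pos hi, if_neg hne, add_zero]
      rw [mul_div_cancel₀ _ (hpos _).ne']
      linarith [min_le_left η (m₀ * p / 2)]
    · by_cases hii : i = i₀
      · simp only [Q, if_neg hi, if_pos hii]
        rw [hii, ← hG]
        have h5 : η * S ≤ p / 2 := by
          refine le_trans ?_ hηp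
          gcongr
          refine hSle.trans ?_
          gcongr
          linarith
        have h6 : d - (1 - η) * S + p ≤ 1 / G - p / 2 := by nlinarith
        have h7 : G * (d - (1 - η) * S + p) ≤ G * (1 / G - p / 2) := by gcongr
        rw [mul_sub, mul_one_div_cancel hGpos.ne'] at h7
        have h8 : m₀ * p ≤ G * p := by gcongr; exact hm _
        linarith [min_le_right η (m₀ * p / 2)]
      · simp only [Q, if_neg hi, if_neg hii]
        have : m₀ * p / 2 ≤ 1 := by
          have : 0 ≤ d - S := by linarith
          have h9 : 2 * p ≤ 1 / G := by linarith
          rw [le_div_iff₀ hGpos] at h9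
          have h8 : m₀ * p ≤ G * p := by gcongr; exact hm _
          linarith
        linarith [min_le_right η (m₀ * p / 2)]
  · rw [← Equiv.sum_comp σ fun l => h l v * Q (σ.symm l)]
    simp only [Equiv.symm_apply_apply]
    rw [hsumQ fun i => h (σ i) v, hβ]
    have h5 : ∑ l ∈ Finset.univ.filter (fun l : Fin N => (l : ℕ) < γ - 1),
        h (σ l) v / h (σ l) v = (γ : ℝ) - 1 := by
      rw [sum_congr rfl fun l _ => div_self (hpos (σ l)).ne', sum_const, hcard, nsmul_eq_mul,
        Nat.cast_sub hγ1, Nat.cast_one, mul_one]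
    rw [h5, ← hG]
    have h6 : G * (1 / G + S - d) = 1 - G * (d - S) := by
      field_simp
      ring
    rw [h6]
    have h7 : 0 ≤ G * (d - S) := mul_nonneg hGpos.le (by linarith)
    have h8 : k * η * (G * S) ≤ m₀ * (((γ : ℝ) - 1) / m₀) := by
      gcongr
      nlinarith
    rw [mul_div_cancel₀ _ hm₀.ne'] at h8
    have h9 : 0 ≤ k * η * ((γ : ℝ) - 1) := by
      have : (0 : ℝ) ≤ (γ : ℝ) - 1 := by linarith
      positivity
    nlinarith

lemma prod_gap_rpow_le {k : ℕ} {B δ H Δ q p R : ℝ} {z : Fin k → ℝ} (hB : 1 ≤ B) (hδ : 0 < δ)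
    (hz0 : ∀ i, 0 < z i) (hz1 : ∀ i, z i ≤ 1) (hpR : p ≤ R) (hq : (H + Δ) * p ≤ q) :
    (∏ i, B * δ ^ (-H) * z i ^ (-(H + Δ))) ^ p ≤
      (B ^ R) ^ k * δ ^ (-(k * (H * p))) * ∏ i, z i ^ (-q) := by
  have hB0 : 0 < B := zero_lt_one.trans_le hB
  rw [← Real.finsetProd_rpow _ _ fun i _ => by have := hz0 i; positivity]
  have h1 : ∀ i, (B * δ ^ (-H) * z i ^ (-(H + Δ))) ^ p ≤ B ^ R * δ ^ (-(H * p)) * z i ^ (-q) :=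
    fun i => by
      have := hz0 i
      rw [Real.mul_rpow (by positivity) (by positivity), Real.mul_rpow hB0.le (by positivity),
        ← Real.rpow_mul hδ.le, ← Real.rpow_mul this.le, neg_mul, neg_mul]
      have h2 := Real.rpow_le_rpow_of_exponent_le hB hpR
      have h3 := Real.rpow_le_rpow_of_exponent_ge this (hz1 i) (neg_le_neg hq)
      gcongr
  refine (prod_le_prod (fun i _ => by have := hz0 i; positivity) fun i _ => h1 i).trans_eq ?_
  rw [prod_mul_distrib, prod_const, card_univ, Fintype.card_fin, mul_pow,
    ← Real.rpow_mul_natCast hδ.le]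
  congr 3
  ring

lemma pow_le_ofReal_prod_rpow {N d : ℕ} {J : ℝ≥0∞} {C : ℝ} {X P : Fin N → ℝ}
    (hN : 0 < N) (hC : 0 ≤ C) (hX : ∀ l, 0 ≤ X l) (hJ : ∀ l, J ≤ ENNReal.ofReal (C * X l))
    (hP : ∀ l, 0 ≤ P l) (hPd : ∑ l, P l = d) :
    J ^ d ≤ ENNReal.ofReal (C ^ d * ∏ l, X l ^ P l) := by
  have hJtop : J ≠ ⊤ := ne_top_of_le_ne_top ENNReal.ofReal_ne_top (hJ ⟨0, hN⟩)
  rw [← ENNReal.ofReal_toReal hJtop, ← ENNReal.ofReal_pow ENNReal.toReal_nonneg]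
  refine ENNReal.ofReal_le_ofReal ?_
  have hJr : ∀ l, J.toReal ≤ C * X l := fun l =>
    ENNReal.toReal_le_of_le_ofReal (mul_nonneg hC (hX l)) (hJ l)
  rw [← Real.rpow_natCast, ← Real.rpow_natCast, ← hPd,
    Real.rpow_sum_of_nonneg ENNReal.toReal_nonneg fun l _ => hP l,
    Real.rpow_sum_of_nonneg hC fun l _ => hP l, ← prod_mul_distrib]
  refine prod_le_prod (fun l _ => Real.rpow_nonneg ENNReal.toReal_nonneg _) fun l _ => ?_
  rw [← Real.mul_rpow hC (hX l)]
  exact Real.rpow_le_rpow ENNReal.toReal_nonneg (hJr l) (hP l)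

/-- For points with distinct coordinates in a cube, the spatial integral is bounded by a product
of integrable gap singularities. -/
lemma exists_lintegral_spatial_le {N : ℕ} (hN : 0 < N) (d k : ℕ) {α ε T κ B R : ℝ} (hα0 : 0 < α)
    (hα2 : α ≤ 2) (hε : 0 < ε) (hκ0 : 0 < κ) (hB : 1 ≤ B) :
    ∃ K ≥ (0 : ℝ), κ ≤ 1 → ∀ h : Fin N → (Fin N → ℝ) → ℝ, (∀ l u, 0 < h l u) →
      (∀ l u, h l u < 1) → ∀ (a : Fin N → ℝ) (δ : ℝ), 0 < δ → δ ≤ 1 →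
      ∀ U : Fin (k + 1) → Fin N → ℝ, (∀ j l, U j l ∈ Set.Icc (a l) (a l + δ)) →
      (∀ j l, ε ≤ U j l) → (∀ j l, U j l ≤ T) → (∀ l, Function.Injective fun j => U j l) →
      ∀ (H : Fin N → ℝ) (Δ q : ℝ), (∀ l, 0 ≤ H l) → 0 ≤ Δ →
      (∀ j l s, 0 < s → s ≤ δ → s ^ (-h l (U j)) ≤ B * δ ^ (-H l) * (s / δ) ^ (-(H l + Δ))) →
      ∀ (P : Fin N → ℝ) (l₀ : Fin N), (∀ l, 0 ≤ P l) → ∑ l, P l = d →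
      (∀ l, P l + (if l = l₀ then (k + 1 : ℕ) * κ else 0) ≤ R) →
      (∀ l, (H l + Δ) * (P l + if l = l₀ then (k + 1 : ℕ) * κ else 0) ≤ q) →
      ∀ x y : EuclideanSpace ℝ (Fin d),
      ∫⁻ V : Fin (k + 1) → EuclideanSpace ℝ (Fin d),
        ‖(∏ j, (Complex.exp (-((∑ k, V j k * x k : ℝ) : ℂ) * Complex.I) -
               Complex.exp (-((∑ k, V j k * y k : ℝ) : ℂ) * Complex.I))) *
          Complex.exp (-((∑ k : Fin d, ∫ w : Fin N → ℝ,
            |∑ j, V j k * kernelG N α h (U j) w| ^ α : ℝ) : ℂ))‖ₑ ≤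
      ENNReal.ofReal (K * ‖x - y‖ ^ ((k + 1 : ℕ) * κ) *
        δ ^ (-(k * ∑ l, H l * (P l + if l = l₀ then (k + 1 : ℕ) * κ else 0)))) *
        ∏ l, chainWeight k q δ (fun j => U j l) := by
  obtain ⟨C, hC1, hdir⟩ := exists_ordered_direction_bounds N (T := T) hα0 hα2 hε k
  set n := k + 1 with hn
  have hn0 : (0 : ℝ) < n := by positivity
  have hB0 : 0 < B := zero_lt_one.trans_le hB
  have hC0 : 0 ≤ C := zero_le_one.trans hC1
  set K₁ : ℝ := 2 ^ n * (d * C) ^ (n * κ) * (2 * (n * κ / α)) ^ (n * κ / α) * C ^ d with hK₁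
  refine ⟨K₁ * ((B ^ R) ^ k) ^ N, by positivity, fun hκ1 h h0 h1 a δ hδ hδ1 U hU hUε hUT hinj H Δ q
    hH hΔ hgap P l₀ hP hPd hPR hPq x y => ?_⟩
  choose π hπ using fun l => exists_perm_strictMono (hinj l)
  set z : Fin N → Fin k → ℝ := fun l i => (U (π l i.succ) l - U (π l i.castSucc) l) / δ with hz
  have hs0 : ∀ l (i : Fin k), 0 < U (π l i.succ) l - U (π l i.castSucc) l := fun l i =>
    sub_pos.2 (hπ l (Fin.castSucc_lt_succ (i := i)))
  have hsδ : ∀ l (i : Fin k), U (π l i.succ) l - U (π l i.castSucc) l ≤ δ := fun l i => by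
    linarith [(hU (π l i.succ) l).2, (hU (π l i.castSucc) l).1]
  have hz0 : ∀ l i, 0 < z l i := fun l i => div_pos (hs0 l i) hδ
  have hz1 : ∀ l i, z l i ≤ 1 := fun l i => (div_le_one hδ).2 (hsδ l i)
  set X : Fin N → ℝ := fun l => ∏ i, B * δ ^ (-H l) * z l i ^ (-(H l + Δ)) with hX
  have hX0 : ∀ l, 0 < X l := fun l => prod_pos fun i _ => by have := hz0 l i; positivity
  set W : (Fin n → ℝ) → ℝ := fun v => ∫ w, |∑ j, v j * kernelG N α h (U j) w| ^ α with hW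
  have hWm : Measurable W := measurable_integral_abs_sum_rpow
    fun j => measurable_kernelG N α h (U j)
  have hW0 : ∀ v, 0 ≤ W v := fun v => integral_nonneg fun w => by positivity
  have hbounds := fun l => hdir h h0 h1 U hUε hUT l (π l) (hπ l)
    (fun i => B * δ ^ (-H l) * z l i ^ (-(H l + Δ)))
    (fun i => by
      have h2 : 1 ≤ δ ^ (-H l) :=
        Real.one_le_rpow_of_pos_of_le_one_of_nonpos hδ hδ1 (by linarith [hH l])
      have h3 : 1 ≤ z l i ^ (-(H l + Δ)) :=
        Real.one_le_rpow_of_pos_of_le_one_of_nonpos (hz0 l i) (hz1 l i) (by linarith [hH l])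
      exact one_le_mul_of_one_le_of_one_le (one_le_mul_of_one_le_of_one_le hB h2) h3)
    (fun i => hgap _ l _ (hs0 l i) (hsδ l i))
  set P' : Fin N → ℝ := fun l => P l + if l = l₀ then n * κ else 0 with hP'
  have hXP : X l₀ ^ (n * κ) * ∏ l, X l ^ P l = ∏ l, X l ^ P' l := by
    have h2 : ∀ l, X l ^ P' l = X l ^ P l * if l = l₀ then X l ^ (n * κ) else 1 := fun l => by
      dsimp only [P']
      rw [Real.rpow_add (hX0 l)]
      split_ifs <;> simp
    simp only [h2, prod_mul_distrib, prod_ite_eq', mem_univ, if_true]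
    ring
  have hXle : ∏ l, X l ^ P' l ≤ ((B ^ R) ^ k) ^ N * δ ^ (-(k * ∑ l, H l * P' l)) *
      ∏ l, ∏ i, z l i ^ (-q) := by
    refine (prod_le_prod (fun l _ => Real.rpow_nonneg (hX0 l).le _) fun l _ =>
      prod_gap_rpow_le hB hδ (hz0 l) (hz1 l) (hPR l) (hPq l)).trans_eq ?_
    rw [prod_mul_distrib, prod_mul_distrib, prod_const, card_univ, Fintype.card_fin,
      ← Real.rpow_sum_of_pos hδ, Finset.sum_neg_distrib, ← Finset.mul_sum]
  have hxy : 0 ≤ ‖x - y‖ := norm_nonneg _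
  refine (lintegral_enorm_increments_mul_exp_le (A := C * X l₀) (by positivity) hκ0 hκ1
    (mul_nonneg hC0 (hX0 l₀).le) hα0 hWm hW0 (hbounds l₀).2 x y).trans ?_
  refine (mul_le_mul_right (pow_le_ofReal_prod_rpow hN hC0 (fun l => (hX0 l).le)
    (fun l => (hbounds l).1) hP hPd) _).trans ?_
  have hweights : ENNReal.ofReal (∏ l, ∏ i, z l i ^ (-q)) ≤
      ∏ l, chainWeight k q δ (fun j => U j l) := by
    rw [ENNReal.ofReal_prod_of_nonneg fun l _ => prod_nonneg fun i _ =>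
      Real.rpow_nonneg (hz0 l i).le _]
    exact Finset.prod_le_prod' fun l _ => ofReal_prod_gap_le_chainWeight (fun j => hU j l) (hπ l)
  refine le_trans ?_ (mul_le_mul_right hweights _)
  have hprod0 : ∀ l, 0 ≤ X l ^ P l := fun l => Real.rpow_nonneg (hX0 l).le _
  have hX00 := (hX0 l₀).le
  rw [← ENNReal.ofReal_mul (by positivity), ← ENNReal.ofReal_mul (by positivity)]
  refine ENNReal.ofReal_le_ofReal ?_
  calc _ = K₁ * ‖x - y‖ ^ (n * κ) * (X l₀ ^ (n * κ) * ∏ l, X l ^ P l) := by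
        rw [show d * (C * X l₀) * ‖x - y‖ = d * C * X l₀ * ‖x - y‖ by ring,
          Real.mul_rpow (by positivity) hxy, Real.mul_rpow (by positivity) hX00, hK₁]
        ring
    _ ≤ K₁ * ‖x - y‖ ^ (n * κ) * (((B ^ R) ^ k) ^ N * δ ^ (-(k * ∑ l, H l * P' l)) *
      ∏ l, ∏ i, z l i ^ (-q)) := by
        rw [hXP]
        gcongr
    _ = _ := by ring

lemma exists_pos_le_forall {N : ℕ} {m : Fin N → ℝ} (hm : ∀ l, 0 < m l) :
    ∃ m₀ > (0 : ℝ), ∀ l, m₀ ≤ m l := by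
  rcases isEmpty_or_nonempty (Fin N) with hN | hN
  · exact ⟨1, one_pos, fun l => isEmptyElim l⟩
  · obtain ⟨l₀, h⟩ := Finite.exists_min m
    exact ⟨m l₀, hm l₀, h⟩

lemma sum_min_rpow_le {N : ℕ} {m M : Fin N → ℝ} {m₀ δ : ℝ} (hm₀ : 0 < m₀) (hm : ∀ l, m₀ ≤ m l)
    (hδ : 0 < δ) (hδ1 : δ ≤ 1) {u v : Fin N → ℝ} (huv : ∀ l, |u l - v l| ≤ δ) :
    ∑ l, min (|u l - v l| ^ m l) (|u l - v l| ^ M l) ≤ N * δ ^ m₀ := by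
  calc _ ≤ ∑ _l : Fin N, δ ^ m₀ := sum_le_sum fun l _ => by
        refine (min_le_left _ _).trans ?_
        calc _ ≤ δ ^ m l := Real.rpow_le_rpow (abs_nonneg _) (huv l) (hm₀.le.trans (hm l))
          _ ≤ _ := Real.rpow_le_rpow_of_exponent_ge hδ hδ1 (hm l)
    _ = _ := by simp

lemma enorm_Dn_le (N d : ℕ) (α : ℝ) (h : Fin N → (Fin N → ℝ) → ℝ) (n : ℕ)
    (S : Set (Fin N → ℝ)) (x y : EuclideanSpace ℝ (Fin d)) :
    ‖Dn N d α h n S x y‖ₑ ≤ ENNReal.ofReal ((2 * Real.pi) ^ (-((n : ℝ) * d))) *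
      ∫⁻ U : Fin n → Fin N → ℝ in {U | ∀ j, U j ∈ S},
        ∫⁻ V : Fin n → EuclideanSpace ℝ (Fin d),
          ‖(∏ j, (Complex.exp (-((∑ k, V j k * x k : ℝ) : ℂ) * Complex.I) -
               Complex.exp (-((∑ k, V j k * y k : ℝ) : ℂ) * Complex.I))) *
          Complex.exp (-((∑ k : Fin d, ∫ w : Fin N → ℝ,
            |∑ j, V j k * kernelG N α h (U j) w| ^ α : ℝ) : ℂ))‖ₑ := by
  rw [Dn, enorm_mul]
  refine mul_le_mul' (le_of_eq ?_) ((enorm_integral_le_lintegral_enorm _).trans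
    (lintegral_mono fun U => enorm_integral_le_lintegral_enorm _))
  rw [← ofReal_norm, Complex.norm_real, Real.norm_of_nonneg (by positivity)]

/-- Lemma 3.6 (analytic content): moment estimate for local-time differences. -/
theorem local_time_difference_moment_bound (N : ℕ) (hN : 1 ≤ N) (d : ℕ) (hd : 1 ≤ d)
    (α : ℝ) (hα0 : 0 < α) (hα2 : α ≤ 2)
    (h : Fin N → (Fin N → ℝ) → ℝ) (m M : Fin N → ℝ)
    (hm : ∀ l, 0 < m l) (hmM : ∀ l, m l ≤ M l) (hM1 : ∀ l, M l < 1)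
    (hH1 : ∀ l u, m l ≤ h l u ∧ h l u ≤ M l)
    (hH2 : ∀ K : Set (Fin N → ℝ), IsCompact K → ∃ c > 0, ∀ u ∈ K, ∀ v ∈ K, ∀ l,
      |h l u - h l v| ≤ c * ∑ l', min (|u l' - v l'| ^ m l') (|u l' - v l'| ^ M l'))
    (ε T : ℝ) (hε : 0 < ε) (hεT : ε < T)
    (hC1 : ∀ v ∈ Set.Icc (fun _ : Fin N => ε) (fun _ => T), (d : ℝ) < ∑ l, 1 / h l v) :
    ∀ n : ℕ, 2 ≤ n → Even n → ∀ κ : ℝ, 0 < κ →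
      ∃ c > (0 : ℝ), ∃ δ₀ : ℝ, 0 < δ₀ ∧ δ₀ ≤ 1 ∧
        ∀ (a : Fin N → ℝ) (δ : ℝ), 0 < δ → δ ≤ δ₀ →
          Set.Icc a (fun l => a l + δ) ⊆ Set.Icc (fun _ : Fin N => ε) (fun _ => T) →
          ∀ ustar ∈ Set.Icc a (fun l => a l + δ), ∀ σ : Equiv.Perm (Fin N),
            (n : ℝ) * κ <
              min 1 (alphaFn N d h σ ustar / (2 * gammaIdx N d h σ ustar)) →
            ∀ x y : EuclideanSpace ℝ (Fin d), ‖x - y‖ ≤ 1 →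
              ‖Dn N d α h n (Set.Icc a (fun l => a l + δ)) x y‖ ≤
                c * ‖x - y‖ ^ ((n : ℝ) * κ) *
                  δ ^ ((n : ℝ) *
                    (betaFn N d h σ ustar -
                      ((n : ℝ) - 1) * hGamma N d h σ ustar * κ)) := by
  intro n hn2 _ κ hκ
  by_cases hnκ : (n : ℝ) * κ < 1
  swap
  · exact ⟨1, one_pos, 1, one_pos, le_rfl, fun _ _ _ _ _ _ _ _ hlt =>
      absurd (hlt.trans_le (min_le_left _ _)) hnκ⟩
  obtain ⟨k, rfl⟩ : ∃ k, n = k + 1 := ⟨n - 1, by omega⟩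
  have hκ1 : κ ≤ 1 := by
    push_cast at hnκ
    nlinarith [(Nat.cast_nonneg k : (0 : ℝ) ≤ k)]
  obtain ⟨m₀, hm₀, hm₀m⟩ := exists_pos_le_forall hm
  obtain ⟨cH, hcH, hHold⟩ := hH2 _ (isCompact_Icc (a := fun _ : Fin N => ε) (b := fun _ => T))
  have hN0 : (0 : ℝ) < N := by exact_mod_cast hN
  have hn0 : (0 : ℝ) < (k + 1 : ℕ) := by positivity
  set p : ℝ := (k + 1 : ℕ) * κ with hp
  have hp0 : 0 < p := by positivity
  set D := cH * N with hD
  have hD0 : 0 < D := by positivity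
  set η : ℝ := min 1 (min (p / 2 / (N / m₀)) (m₀ / (k + 1 : ℕ))) with hη
  have hη0 : 0 < η := by positivity
  have hη1 : η ≤ 1 := min_le_left _ _
  have hηp : η * (N / m₀) ≤ p / 2 := by
    rw [← le_div_iff₀ (by positivity)]
    exact (min_le_right _ _).trans (min_le_left _ _)
  have hηk : k * η ≤ m₀ := by
    have h1 : η ≤ m₀ / (k + 1 : ℕ) := (min_le_right _ _).trans (min_le_right _ _)
    rw [le_div_iff₀ hn0] at h1
    push_cast at h1
    nlinarith
  set θ : ℝ := min η (m₀ * p / 2) with hθ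
  have hθ0 : 0 < θ := by positivity
  set Δ : ℝ := m₀ * θ / 2 with hΔ
  have hΔ0 : 0 < Δ := by positivity
  set q : ℝ := 1 - θ / 2 with hq
  have hq1 : q < 1 := by linarith
  set B : ℝ := Real.exp (D / m₀) with hB
  have hB1 : 1 ≤ B := Real.one_le_exp (by positivity)
  obtain ⟨K, hK0, hK⟩ := exists_lintegral_spatial_le (T := T) (R := 1 / m₀) hN d k hα0 hα2 hε hκ hB1
  set G : ℝ := ((k + 1).factorial * (1 / (1 - q)) ^ k) ^ N with hG
  have hG0 : 0 ≤ G := by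
    have : 0 < 1 - q := by linarith
    positivity
  set A : ℝ := (2 * Real.pi) ^ (-(((k + 1 : ℕ) : ℝ) * d)) with hA
  have hA0 : 0 ≤ A := by positivity
  refine ⟨A * K * G + 1, by positivity, min 1 ((Δ / D) ^ (1 / m₀)), by positivity, min_le_left _ _,
    fun a δ hδ hδ₀ hsub ustar hustar σ hσ x y _ => ?_⟩
  have hδ1 : δ ≤ 1 := hδ₀.trans (min_le_left _ _)
  have hδΔ : D * δ ^ m₀ ≤ Δ := by
    have h1 := Real.rpow_le_rpow hδ.le (hδ₀.trans (min_le_right _ _)) hm₀.le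
    rw [← Real.rpow_mul (by positivity), one_div_mul_cancel hm₀.ne', Real.rpow_one,
      le_div_iff₀ hD0] at h1
    linarith
  have h0 : ∀ l u, 0 < h l u := fun l u => (hm l).trans_le (hH1 l u).1
  have h1 : ∀ l u, h l u < 1 := fun l u => (hH1 l u).2.trans_lt (hM1 l)
  have hmh : ∀ l u, m₀ ≤ h l u := fun l u => (hm₀m l).trans (hH1 l u).1
  obtain ⟨P, l₀, hP0, hPd, hl₀, hPq, hPβ⟩ := exists_interpolation_exponents (k := k) hm₀
    (fun l => hmh l ustar) (fun l => h1 l ustar) (hC1 _ (hsub hustar)) hp0 hη0.le hη1 hηp hηk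
    (hσ.trans_le (min_le_right _ _))
  set P' : Fin N → ℝ := fun l => P l + if l = l₀ then p else 0 with hP'
  have hP'0 : ∀ l, 0 ≤ P' l := fun l => by
    have := hP0 l
    dsimp only [P']
    split_ifs <;> positivity
  have hPR : ∀ l, P' l ≤ 1 / m₀ := fun l => by
    rw [le_div_iff₀ hm₀]
    have h2 : h l ustar * P' l ≤ 1 - θ := hPq l
    have h3 : m₀ * P' l ≤ h l ustar * P' l := mul_le_mul_of_nonneg_right (hmh l _) (hP'0 l)
    linarith
  have hPq' : ∀ l, (h l ustar + Δ) * P' l ≤ q := fun l => by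
    have h2 : h l ustar * P' l ≤ 1 - θ := hPq l
    have h3 : Δ * P' l ≤ Δ * (1 / m₀) := mul_le_mul_of_nonneg_left (hPR l) hΔ0.le
    have h4 : Δ * (1 / m₀) = θ / 2 := by rw [hΔ]; field_simp
    linarith
  set E : ℝ := ((k + 1 : ℕ) : ℝ) * (betaFn N d h σ ustar -
    (((k + 1 : ℕ) : ℝ) - 1) * hGamma N d h σ ustar * κ) with hE
  set Q : ℝ := k * ∑ l, h l ustar * P' l with hQ
  have hQE : E ≤ (k + 1 : ℕ) * N - Q := by
    have h2 : ∑ l, h l ustar * P' l = ∑ l, h l ustar * P l + h l₀ ustar * p := by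
      simp only [P', mul_add, sum_add_distrib, mul_ite, mul_zero, sum_ite_eq', mem_univ, if_true]
    rw [hQ, hE, h2, hl₀, hp]
    push_cast
    nlinarith
  have hpoint : ∀ᵐ U : Fin (k + 1) → Fin N → ℝ,
      U ∈ {U : Fin (k + 1) → Fin N → ℝ | ∀ j, U j ∈ Set.Icc a (fun l => a l + δ)} →
      ∫⁻ V : Fin (k + 1) → EuclideanSpace ℝ (Fin d),
          ‖(∏ j, (Complex.exp (-((∑ k, V j k * x k : ℝ) : ℂ) * Complex.I) -
               Complex.exp (-((∑ k, V j k * y k : ℝ) : ℂ) * Complex.I))) *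
          Complex.exp (-((∑ k : Fin d, ∫ w : Fin N → ℝ,
            |∑ j, V j k * kernelG N α h (U j) w| ^ α : ℝ) : ℂ))‖ₑ ≤
        ENNReal.ofReal (K * ‖x - y‖ ^ p * δ ^ (-Q)) *
          ∏ l, chainWeight k q δ (fun j => U j l) := by
    filter_upwards [ae_injective_coordinates (k + 1) N] with U hinj hU
    refine hK hκ1 h h0 h1 a δ hδ hδ1 U (fun j l => ⟨(hU j).1 l, (hU j).2 l⟩)
      (fun j l => (hsub (hU j)).1 l) (fun j l => (hsub (hU j)).2 l) hinj (fun l => h l ustar) Δ q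
      (fun l => (h0 l _).le) hΔ0.le (fun j l s hs hsδ => ?_) P l₀ hP0 hPd hPR hPq' x y
    refine rpow_neg_gap_le hs hsδ hδ1 hm₀ hD0.le ?_ hδΔ
    refine (hHold _ (hsub (hU j)) _ (hsub hustar) l).trans ?_
    rw [hD, mul_assoc]
    refine mul_le_mul_of_nonneg_left (sum_min_rpow_le hm₀ hm₀m hδ hδ1 fun l' => ?_) hcH.le
    rw [abs_le]
    have h2 := (hU j).1 l'
    have h3 := (hU j).2 l'
    have h4 := hustar.1 l'
    have h5 := hustar.2 l'
    constructor <;> linarith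
  have hset : MeasurableSet
      {U : Fin (k + 1) → Fin N → ℝ | ∀ j, U j ∈ Set.Icc a (fun l => a l + δ)} := by
    rw [Set.ofPred_forall]
    exact .iInter fun j => measurableSet_Icc.preimage (measurable_pi_apply j)
  have hmain : ‖Dn N d α h (k + 1) (Set.Icc a (fun l => a l + δ)) x y‖ₑ ≤
      ENNReal.ofReal (A * (K * ‖x - y‖ ^ p * δ ^ (-Q)) * (G * δ ^ (((k + 1 : ℕ) : ℝ) * N))) := by
    refine (enorm_Dn_le N d α h (k + 1) _ x y).trans ?_
    rw [mul_assoc, ENNReal.ofReal_mul hA0, ENNReal.ofReal_mul (by positivity)]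
    refine mul_le_mul_right ((setLIntegral_mono_ae' hset hpoint).trans ?_) _
    rw [lintegral_const_mul' _ _ ENNReal.ofReal_ne_top]
    refine mul_le_mul_right ((setLIntegral_prod_chainWeight_le hq1 hδ a k).trans_eq ?_) _
    rw [mul_pow, Real.rpow_mul hδ.le, Real.rpow_natCast, Real.rpow_natCast]
  have hfinal := ENNReal.toReal_mono ENNReal.ofReal_ne_top hmain
  rw [toReal_enorm, ENNReal.toReal_ofReal (by positivity)] at hfinal
  refine hfinal.trans ?_
  have hδE : δ ^ (-Q) * δ ^ (((k + 1 : ℕ) : ℝ) * N) ≤ δ ^ E := by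
    rw [← Real.rpow_add hδ]
    exact Real.rpow_le_rpow_of_exponent_ge hδ hδ1 (by linarith)
  calc _ = A * K * G * ‖x - y‖ ^ p * (δ ^ (-Q) * δ ^ (((k + 1 : ℕ) : ℝ) * N)) := by ring
    _ ≤ A * K * G * ‖x - y‖ ^ p * δ ^ E := by gcongr
    _ ≤ _ := by gcongr; linarith
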